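/- There is an absolute constant c such that for any prime p, subsets A, B ⊆ F_p with |A| = A ≤ |B| = B, and λ, μ ∈ F_p^*, the number T_{λ,μ}(A,B) of solutions (a₁,a₂,a₃,b₁,b₂,b₃) ∈ A³ × B³ of (a₁ − λa₂)(b₁ − μb₂) = (a₁ − λa₃)(b₁ − μb₃) satisfies |T_{λ,μ}(A,B) − A³B³/p| ≤ c·(p^{1/2}A²B^{3/2} + AB³). -/

import Mathlib

open Finset

/-- `T_{λ,μ}(A,B)`: the number of solutions `(a₁,a₂,a₃,b₁,b₂,b₃) ∈ A³ × B³` of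
`(a₁ − λa₂)(b₁ − μb₂) = (a₁ − λa₃)(b₁ − μb₃)`. -/
def collinearTriples {p : ℕ} [Fact p.Prime] (A B : Finset (ZMod p)) (lam mu : ZMod p) : ℕ :=
  Fintype.card {t : ZMod p × ZMod p × ZMod p × ZMod p × ZMod p × ZMod p //
    t.1 ∈ A ∧ t.2.1 ∈ A ∧ t.2.2.1 ∈ A ∧ t.2.2.2.1 ∈ B ∧ t.2.2.2.2.1 ∈ B ∧ t.2.2.2.2.2 ∈ B ∧
    (t.1 - lam * t.2.1) * (t.2.2.2.1 - mu * t.2.2.2.2.1)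
      = (t.1 - lam * t.2.2.1) * (t.2.2.2.1 - mu * t.2.2.2.2.2)}



namespace CT

open Polynomial in
/-- restriction to the line `(s Z + t, y, Z)` -/
noncomputable def ev2 {K : Type*} [Field K] (g : K × K × K) :
    MvPolynomial (Fin 3) K →ₐ[K] K[X] :=
  MvPolynomial.aeval ![C g.1 * X + C g.2.1, C g.2.2, X]

open Polynomial in
/-- restriction to the line `(u Y + v, Y, z)` -/
noncomputable def ev1 {K : Type*} [Field K] (f : K × K × K) :
    MvPolynomial (Fin 3) K →ₐ[K] K[X] :=
  MvPolynomial.aeval ![C f.1 * X + C f.2.1, X, C f.2.2]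

/-- incidence -/
def Inc {K : Type*} [Field K] (f g : K × K × K) : Prop :=
  f.1 * g.2.2 + f.2.1 = g.1 * f.2.2 + g.2.1

variable {K : Type*} [Field K]

lemma inc_comm (f g : K × K × K) : Inc f g ↔ Inc g f := by
  unfold Inc; exact eq_comm

open Polynomial in
lemma two_var_count (R : MvPolynomial (Fin 2) K) (hR : R ≠ 0) (Ys : Finset K)
    (h : ∀ y ∈ Ys, MvPolynomial.aeval ![C y, (X : K[X])] R = 0) : Ys.card ≤ R.totalDegree := by
  classical
  set r := MvPolynomial.finSuccEquiv K 1 R with hr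
  have hr0 : r ≠ 0 := by
    rw [hr]; simpa using hR
  let φ : MvPolynomial (Fin 1) K →ₐ[K] K[X] := MvPolynomial.aeval ![X]
  have hφ : Function.Injective φ := by
    have : AlgebraicIndependent K ![(X : K[X])] := by
      rw [algebraicIndependent_unique_type_iff]
      simpa using Polynomial.transcendental_X K
    exact this
  have key : ∀ y : K, φ (r.eval (MvPolynomial.C y)) = MvPolynomial.aeval ![C y, (X : K[X])] R := by
    intro y
    rw [hr]
    have : (φ.comp ((Polynomial.aeval (R := MvPolynomial (Fin 1) K) (MvPolynomial.C y : MvPolynomial (Fin 1) K)).restrictScalars K)).comp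
        (MvPolynomial.finSuccEquiv K 1).toAlgHom = MvPolynomial.aeval ![C y, (X : K[X])] := by
      apply MvPolynomial.algHom_ext
      intro i
      fin_cases i
      · simp [φ, MvPolynomial.finSuccEquiv_X_zero]
      · have := MvPolynomial.finSuccEquiv_X_succ (R := K) (n := 1) (j := 0)
        simp at this
        simp [φ, this]
    rw [← this]
    simp [Polynomial.aeval_def, Polynomial.eval₂_eq_eval_map]
  have h2 : (Ys.image (fun y => (MvPolynomial.C y : MvPolynomial (Fin 1) K))).val ⊆ r.roots := by
    intro x hx
    simp only [Finset.mem_val, Finset.mem_image] at hx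
    obtain ⟨y, hy, rfl⟩ := hx
    rw [Polynomial.mem_roots hr0, Polynomial.IsRoot]
    apply hφ
    rw [key, h y hy, map_zero]
  have h3 := Polynomial.card_le_degree_of_subset_roots h2
  rw [Finset.card_image_of_injective _ (MvPolynomial.C_injective _ _)] at h3
  refine h3.trans ?_
  rw [hr, MvPolynomial.natDegree_finSuccEquiv]
  exact MvPolynomial.degreeOf_le_totalDegree _ _

open Polynomial in
lemma resultant_totalDegree {n : ℕ} (Q G : MvPolynomial (Fin (n+1)) K) (a b : ℕ) :
    (resultant (MvPolynomial.finSuccEquiv K n Q) (MvPolynomial.finSuccEquiv K n G) a b).totalDegree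
      ≤ a * G.totalDegree + b * Q.totalDegree := by
  classical
  unfold resultant
  rw [Matrix.det_apply]
  have hc : ∀ (P : MvPolynomial (Fin (n+1)) K) i,
      ((MvPolynomial.finSuccEquiv K n P).coeff i).totalDegree ≤ P.totalDegree := by
    intro P i
    by_cases h : (MvPolynomial.finSuccEquiv K n P).coeff i = 0
    · simp [h]
    · have := MvPolynomial.totalDegree_coeff_finSuccEquiv_add_le P i h
      omega
  apply MvPolynomial.totalDegree_finsetSum_le
  intro σ _
  refine (MvPolynomial.totalDegree_smul_le _ _).trans ?_
  refine (MvPolynomial.totalDegree_finsetProd _ _).trans ?_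
  rw [Fin.sum_univ_add]
  apply Nat.add_le_add
  · refine (Finset.sum_le_card_nsmul _ _ G.totalDegree ?_).trans (by simp)
    intro i _
    simp only [sylvester, Matrix.of_apply, Fin.addCases_left]
    split_ifs
    · exact hc _ _
    · simp
  · refine (Finset.sum_le_card_nsmul _ _ Q.totalDegree ?_).trans (by simp)
    intro i _
    simp only [sylvester, Matrix.of_apply, Fin.addCases_right]
    split_ifs
    · exact hc _ _
    · simp

open Polynomial in
/-- Bezout for lines. -/
lemma bezout (Q G : MvPolynomial (Fin 3) K) (hQ : Irreducible Q) (hd : Q.degreeOf 0 ≠ 0)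
    (hG : ¬ Q ∣ G) (F : Finset (K × K × K)) (hF : Set.InjOn (fun g => g.2.2) (F : Set (K × K × K)))
    (h1 : ∀ g ∈ F, ev2 g Q = 0) (h2 : ∀ g ∈ F, ev2 g G = 0) :
    F.card ≤ 2 * (Q.totalDegree * G.totalDegree) := by
  classical
  set q := MvPolynomial.finSuccEquiv K 2 Q with hq
  set r := MvPolynomial.finSuccEquiv K 2 G with hr
  have hqd : q.natDegree ≠ 0 := by rwa [hq, MvPolynomial.natDegree_finSuccEquiv]
  have hqi : Irreducible q := by
    rw [hq]
    exact (MulEquiv.irreducible_iff (MvPolynomial.finSuccEquiv K 2)).2 hQ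
  have hqp := hqi.isPrimitive hqd
  have hqr : ¬ q ∣ r := by
    rw [hq, hr, map_dvd_iff]; exact hG
  let FF := FractionRing (MvPolynomial (Fin 2) K)
  have hinj : Function.Injective (algebraMap (MvPolynomial (Fin 2) K) FF) :=
    IsFractionRing.injective _ _
  have hres : resultant q r ≠ 0 := by
    intro h0
    have := resultant_map_map q r q.natDegree r.natDegree (algebraMap (MvPolynomial (Fin 2) K) FF)
    rw [h0, map_zero] at this
    rw [← Polynomial.natDegree_map_eq_of_injective hinj q,
      ← Polynomial.natDegree_map_eq_of_injective hinj r, resultant_eq_zero_iff] at this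
    apply this.2
    rw [Irreducible.coprime_iff_not_dvd]
    · rwa [← hqp.dvd_iff_fraction_map_dvd_fraction_map FF]
    · rwa [← hqp.irreducible_iff_irreducible_map_fraction_map]
  obtain ⟨a, b, -, -, hab⟩ := exists_mul_add_mul_eq_C_resultant q r le_rfl le_rfl (Or.inl hqd)
  have hY : ∀ y ∈ F.image (fun g => g.2.2),
      MvPolynomial.aeval ![C y, (X : K[X])] (resultant q r) = 0 := by
    intro y hy
    obtain ⟨g, hg, rfl⟩ := Finset.mem_image.1 hy
    -- express via ev2
    have e1 : ∀ R : MvPolynomial (Fin 2) K,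
        ev2 g ((MvPolynomial.finSuccEquiv K 2).symm (C R)) =
          MvPolynomial.aeval ![C g.2.2, (X : K[X])] R := by
      intro R
      have : (MvPolynomial.finSuccEquiv K 2).symm (C R) = MvPolynomial.rename Fin.succ R := by
        rw [AlgEquiv.symm_apply_eq]
        induction R using MvPolynomial.induction_on with
        | C a => simp [MvPolynomial.finSuccEquiv_apply, MvPolynomial.algebraMap_eq]
        | add p q hp hq => simp [hp, hq]
        | mul_X p i hp => rw [map_mul, map_mul, map_mul, hp, MvPolynomial.rename_X, MvPolynomial.finSuccEquiv_X_succ]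
      rw [this, ev2, MvPolynomial.aeval_rename]
      congr 2
    rw [← e1, ← hab, map_add, map_mul, map_mul, map_add, map_mul, map_mul, hq, hr]
    simp [h1 g hg, h2 g hg]
  have := two_var_count _ hres _ hY
  rw [Finset.card_image_of_injOn hF] at this
  refine this.trans ((resultant_totalDegree Q G _ _).trans ?_)
  have hQ' : q.natDegree ≤ Q.totalDegree := by
    rw [hq, MvPolynomial.natDegree_finSuccEquiv]; exact MvPolynomial.degreeOf_le_totalDegree _ _
  have hG' : r.natDegree ≤ G.totalDegree := by
    rw [hr, MvPolynomial.natDegree_finSuccEquiv]; exact MvPolynomial.degreeOf_le_totalDegree _ _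
  nlinarith [Nat.mul_le_mul_right G.totalDegree hQ', Nat.mul_le_mul_right Q.totalDegree hG']

end CT

namespace CT
variable {K : Type*} [Field K]

open Polynomial in
lemma ev_inc (f g : K × K × K) (h : Inc f g) (P : MvPolynomial (Fin 3) K) :
    (ev2 g P).eval f.2.2 = (ev1 f P).eval g.2.2 := by
  have : (Polynomial.aeval (R := K) f.2.2).comp (ev2 g) = (Polynomial.aeval (R := K) g.2.2).comp (ev1 f) := by
    apply MvPolynomial.algHom_ext
    intro i
    unfold Inc at h
    fin_cases i
    · simp [ev1, ev2, h]
    · simp [ev1, ev2]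
    · simp [ev1, ev2]
  have h2 := DFunLike.congr_fun this P
  simpa [Polynomial.aeval_def] using h2

open Polynomial in
lemma natDegree_ev2_le (g : K × K × K) (P : MvPolynomial (Fin 3) K) :
    (ev2 g P).natDegree ≤ P.totalDegree := by
  refine (MvPolynomial.aeval_natDegree_le (n := 1) (m := P.totalDegree) _ le_rfl _ ?_).trans (by simp)
  intro i
  fin_cases i
  · simp only [Fin.zero_eta, Matrix.cons_val_zero]; compute_degree
  · simp
  · simp

open Polynomial in
lemma natDegree_ev1_le (g : K × K × K) (P : MvPolynomial (Fin 3) K) :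
    (ev1 g P).natDegree ≤ P.totalDegree := by
  refine (MvPolynomial.aeval_natDegree_le (n := 1) (m := P.totalDegree) _ le_rfl _ ?_).trans (by simp)
  intro i
  fin_cases i
  · simp only [Fin.zero_eta, Matrix.cons_val_zero]; compute_degree
  · simp
  · simp

open Polynomial in
lemma low_deg (Q : MvPolynomial (Fin 3) K) (hQ : Q ≠ 0) (hd : Q.degreeOf 0 = 0)
    (F : Finset (K × K × K)) (hF : Set.InjOn (fun g => g.2.2) (F : Set (K × K × K)))
    (h1 : ∀ g ∈ F, ev2 g Q = 0) : F.card ≤ Q.totalDegree := by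
  classical
  set q := MvPolynomial.finSuccEquiv K 2 Q with hq
  have hqd : q.natDegree = 0 := by rwa [hq, MvPolynomial.natDegree_finSuccEquiv]
  obtain ⟨R, hR⟩ : ∃ R, q = C R := ⟨_, Polynomial.eq_C_of_natDegree_eq_zero hqd⟩
  have hR2 : Q = MvPolynomial.rename Fin.succ R := by
    apply (MvPolynomial.finSuccEquiv K 2).injective
    rw [← hq, hR]
    clear hR
    induction R using MvPolynomial.induction_on with
    | C a => simp [MvPolynomial.finSuccEquiv_apply, MvPolynomial.algebraMap_eq]
    | add p q hp hq => simp [hp, hq]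
    | mul_X p i hp => rw [map_mul, map_mul, map_mul, hp, MvPolynomial.rename_X, MvPolynomial.finSuccEquiv_X_succ]
  have hR0 : R ≠ 0 := by rintro rfl; simp at hR2; exact hQ hR2
  have := two_var_count R hR0 (F.image (fun g => g.2.2)) (by
    intro y hy
    obtain ⟨g, hg, rfl⟩ := Finset.mem_image.1 hy
    rw [← h1 g hg, hR2, ev2, MvPolynomial.aeval_rename]
    congr 2)
  rw [Finset.card_image_of_injOn hF] at this
  refine this.trans ?_
  have e : R = MvPolynomial.rename (Fin.cases 0 id : Fin 3 → Fin 2) Q := by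
    rw [hR2, MvPolynomial.rename_rename]
    have : ((Fin.cases 0 id : Fin 3 → Fin 2) ∘ Fin.succ) = id := by
      funext i; simp
    rw [this]; simp
  rw [e]
  exact MvPolynomial.totalDegree_rename_le _ _

open Polynomial in
lemma chain2 (g : K × K × K) (P : MvPolynomial (Fin 3) K) :
    derivative (ev2 g P) = ev2 g (MvPolynomial.pderiv 2 P) +
      C g.1 * ev2 g (MvPolynomial.pderiv 0 P) := by
  induction P using MvPolynomial.induction_on with
  | C a => simp [ev2]
  | add p q hp hq => simp only [map_add, hp, hq]; ring
  | mul_X p i hp =>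
    simp only [map_mul, derivative_mul, hp, MvPolynomial.pderiv_mul, map_add]
    fin_cases i
    · simp [ev2, MvPolynomial.pderiv_X]; ring
    · simp [ev2, MvPolynomial.pderiv_X]; ring
    · simp [ev2, MvPolynomial.pderiv_X]; ring

open Polynomial in
lemma chain1 (g : K × K × K) (P : MvPolynomial (Fin 3) K) :
    derivative (ev1 g P) = C g.1 * ev1 g (MvPolynomial.pderiv 0 P) + 
       ev1 g (MvPolynomial.pderiv 1 P) := by
  induction P using MvPolynomial.induction_on with
  | C a => simp [ev1]
  | add p q hp hq => simp only [map_add, hp, hq]; ring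
  | mul_X p i hp =>
    simp only [map_mul, derivative_mul, hp, MvPolynomial.pderiv_mul, map_add]
    fin_cases i
    · simp [ev1, MvPolynomial.pderiv_X]; ring
    · simp [ev1, MvPolynomial.pderiv_X]; ring
    · simp [ev1, MvPolynomial.pderiv_X]; ring

lemma pd_comm (i j : Fin 3) (P : MvPolynomial (Fin 3) K) :
    MvPolynomial.pderiv i (MvPolynomial.pderiv j P) = MvPolynomial.pderiv j (MvPolynomial.pderiv i P) := by
  induction P using MvPolynomial.induction_on with
  | C a => simp
  | add p q hp hq => simp [hp, hq]
  | mul_X p k hp =>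
    simp only [MvPolynomial.pderiv_mul, map_add, hp, MvPolynomial.pderiv_X, Pi.single_apply]
    split_ifs <;> simp <;> ring

lemma totalDegree_pderiv (i : Fin 3) (P : MvPolynomial (Fin 3) K) :
    (MvPolynomial.pderiv i P).totalDegree ≤ P.totalDegree - 1 := by
  unfold MvPolynomial.totalDegree
  apply Finset.sup_le
  intro m hm
  rw [MvPolynomial.mem_support_iff, MvPolynomial.coeff_pderiv] at hm
  have h1 : m + Finsupp.single i 1 ∈ P.support := by
    rw [MvPolynomial.mem_support_iff]
    exact left_ne_zero_of_mul hm
  have h2 := MvPolynomial.le_totalDegree h1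
  rw [Finsupp.sum_add_index' (by simp) (by simp)] at h2
  simp at h2
  change _ ≤ P.totalDegree - 1
  omega

lemma pderiv_ne_zero (p : ℕ) [CharP K p] (P : MvPolynomial (Fin 3) K)
    (h0 : P.degreeOf 0 ≠ 0) (hp : P.degreeOf 0 < p) : MvPolynomial.pderiv 0 P ≠ 0 := by
  classical
  obtain ⟨m, hm, hm0⟩ : ∃ m ∈ P.support, m 0 ≠ 0 := by
    by_contra! h
    apply h0
    have := (MvPolynomial.degreeOf_le_iff (n := 0) (f := P) (d := 0)).2 (fun m hm => (h m hm).le)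
    omega
  intro h
  set m' : Fin 3 →₀ ℕ := m - Finsupp.single 0 1 with hm'
  have h2 := MvPolynomial.coeff_pderiv (i := 0) P m'
  have h3 : m' + Finsupp.single 0 1 = m :=
    Finsupp.sub_add_single_one_cancel hm0
  rw [h, h3, MvPolynomial.coeff_zero] at h2
  have h4 := MvPolynomial.monomial_le_degreeOf 0 hm
  rcases mul_eq_zero.1 h2.symm with h5 | h5
  · exact (MvPolynomial.mem_support_iff.1 hm) h5
  · have h6 : ((m 0 : ℕ) : K) = 0 := by
      rw [← h5]
      have : m 0 = m' 0 + 1 := by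
        simp [hm']; omega
      rw [this]; push_cast; rfl
    rw [CharP.cast_eq_zero_iff K p] at h6
    exact absurd (Nat.le_of_dvd (by omega) h6) (by omega)

end CT

namespace CT
open scoped Classical
variable {K : Type*} [Field K]

section ode
open Polynomial

lemma coeff_X_der (n : K[X]) (a : ℕ) : (X * derivative n).coeff a = a * n.coeff a := by
  cases a with
  | zero => simp
  | succ a => rw [coeff_X_mul, coeff_derivative]; push_cast; ring

lemma ode_deg (p : ℕ) [CharP K p] (n h : K[X]) (hn : n ≠ 0) (hh : h ≠ 0)
    (e : derivative n * h = n * derivative h) (h1 : n.natDegree < p) (h2 : h.natDegree < p) :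
    n.natDegree = h.natDegree := by
  have e2 : (X * derivative n) * h = n * (X * derivative h) := by linear_combination X * e
  have d1 : ∀ q : K[X], (X * derivative q).natDegree ≤ q.natDegree := by
    intro q
    rw [natDegree_le_iff_coeff_eq_zero]
    intro N hN
    rw [coeff_X_der, coeff_eq_zero_of_natDegree_lt hN, mul_zero]
  have c1 := coeff_mul_add_eq_of_natDegree_le (d1 n) (le_refl h.natDegree)
  have c2 := coeff_mul_add_eq_of_natDegree_le (le_refl n.natDegree) (d1 h)
  rw [e2, c2, coeff_X_der, coeff_X_der] at c1
  have c3 : ((h.natDegree : K) - n.natDegree) * (n.leadingCoeff * h.leadingCoeff) = 0 := by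
    unfold leadingCoeff
    linear_combination c1
  have c4 : (h.natDegree : K) = n.natDegree := by
    rcases mul_eq_zero.1 c3 with h | h
    · exact sub_eq_zero.1 h
    · exact absurd h (mul_ne_zero (leadingCoeff_ne_zero.2 hn) (leadingCoeff_ne_zero.2 hh))
  exact (CharP.natCast_injOn_Iio K p (by simpa using h2) (by simpa using h1) c4).symm

lemma ode (p : ℕ) [CharP K p] (n h : K[X]) (hh : h ≠ 0)
    (e : derivative n * h = n * derivative h) (h1 : n.natDegree < p) (h2 : h.natDegree < p) :
    ∃ c : K, n = C c * h := by
  by_cases hn : n = 0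
  · exact ⟨0, by simp [hn]⟩
  have hd := ode_deg p n h hn hh e h1 h2
  refine ⟨n.leadingCoeff / h.leadingCoeff, ?_⟩
  set c := n.leadingCoeff / h.leadingCoeff with hc
  have hc0 : c ≠ 0 := div_ne_zero (leadingCoeff_ne_zero.2 hn) (leadingCoeff_ne_zero.2 hh)
  by_contra hne
  have hm : n - C c * h ≠ 0 := sub_ne_zero.2 hne
  have hdeg : (n - C c * h).degree < n.degree := by
    apply degree_sub_lt_left
    · rw [degree_C_mul hc0, degree_eq_natDegree hn, degree_eq_natDegree hh, hd]
    · exact hn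
    · rw [leadingCoeff_mul, leadingCoeff_C, hc, div_mul_cancel₀ _ (leadingCoeff_ne_zero.2 hh)]
  have hnd := natDegree_lt_natDegree hm hdeg
  have := ode_deg p (n - C c * h) h hm hh (by
    simp only [derivative_sub, derivative_mul, derivative_C]; linear_combination e) (by omega) h2
  omega

lemma root_count (F1 : Finset (K × K × K))
    (hF1 : Set.InjOn (fun g => g.2.2) (F1 : Set (K × K × K))) (P : K[X]) (hP : P ≠ 0) :
    (F1.filter (fun f => P.eval f.2.2 = 0)).card ≤ P.natDegree := by
  have h1 : Set.InjOn (fun g : K × K × K => g.2.2) (F1.filter (fun f => P.eval f.2.2 = 0) : Set (K × K × K)) := by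
    intro x hx y hy
    simp at hx hy
    exact hF1 hx.1 hy.1
  rw [← Finset.card_image_of_injOn h1]
  apply Polynomial.card_le_degree_of_subset_roots
  intro x hx
  rw [Finset.mem_val, Finset.mem_image] at hx
  obtain ⟨f, hf, rfl⟩ := hx
  rw [mem_filter] at hf
  rw [mem_roots hP]
  exact hf.2

end ode

section prime
open Polynomial

/-- the key polynomial -/
noncomputable def HH (Q : MvPolynomial (Fin 3) K) : MvPolynomial (Fin 3) K :=
  MvPolynomial.pderiv 0 Q * MvPolynomial.pderiv 0 Q * MvPolynomial.pderiv 2 (MvPolynomial.pderiv 2 Q)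
  - (MvPolynomial.pderiv 0 Q * MvPolynomial.pderiv 2 Q * MvPolynomial.pderiv 2 (MvPolynomial.pderiv 0 Q)
    + MvPolynomial.pderiv 0 Q * MvPolynomial.pderiv 2 Q * MvPolynomial.pderiv 2 (MvPolynomial.pderiv 0 Q))
  + MvPolynomial.pderiv 2 Q * MvPolynomial.pderiv 2 Q * MvPolynomial.pderiv 0 (MvPolynomial.pderiv 0 Q)

lemma HH_deg (Q : MvPolynomial (Fin 3) K) : (HH Q).totalDegree ≤ 3 * Q.totalDegree := by
  have d1 : ∀ i, (MvPolynomial.pderiv i Q).totalDegree ≤ Q.totalDegree := fun i =>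
    (totalDegree_pderiv i Q).trans (Nat.sub_le _ _)
  have d2 : ∀ i j, (MvPolynomial.pderiv i (MvPolynomial.pderiv j Q)).totalDegree ≤ Q.totalDegree := fun i j =>
    (totalDegree_pderiv i _).trans ((Nat.sub_le _ _).trans (d1 j))
  have d3 : ∀ a b c : MvPolynomial (Fin 3) K, a.totalDegree ≤ Q.totalDegree → b.totalDegree ≤ Q.totalDegree →
      c.totalDegree ≤ Q.totalDegree → (a * b * c).totalDegree ≤ 3 * Q.totalDegree := by
    intro a b c ha hb hc
    have := MvPolynomial.totalDegree_mul (a * b) c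
    have := MvPolynomial.totalDegree_mul a b
    omega
  unfold HH
  refine (MvPolynomial.totalDegree_add _ _).trans (max_le ?_ (d3 _ _ _ (d1 _) (d1 _) (d2 _ _)))
  refine (MvPolynomial.totalDegree_sub _ _).trans (max_le (d3 _ _ _ (d1 _) (d1 _) (d2 _ _)) ?_)
  exact (MvPolynomial.totalDegree_add _ _).trans (max_le (d3 _ _ _ (d1 _) (d1 _) (d2 _ _)) (d3 _ _ _ (d1 _) (d1 _) (d2 _ _)))

lemma HH_vanish (Q : MvPolynomial (Fin 3) K) (g : K × K × K) (h : ev2 g Q = 0) : ev2 g (HH Q) = 0 := by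
  have e1 := chain2 g Q
  have e2 := chain2 g (MvPolynomial.pderiv 0 Q)
  have e3 := chain2 g (MvPolynomial.pderiv 2 Q)
  rw [h, derivative_zero] at e1
  have e1' : ev2 g (MvPolynomial.pderiv 2 Q) = - (C g.1 * ev2 g (MvPolynomial.pderiv 0 Q)) := by
    linear_combination -e1
  rw [pd_comm 0 2] at e3
  rw [e1'] at e3
  simp only [derivative_neg, derivative_mul, derivative_C] at e3
  simp only [HH, map_add, map_sub, map_mul, e1']
  generalize ev2 g (MvPolynomial.pderiv 0 Q) = a at *
  generalize ev2 g (MvPolynomial.pderiv 2 (MvPolynomial.pderiv 0 Q)) = xz at *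
  generalize ev2 g (MvPolynomial.pderiv 2 (MvPolynomial.pderiv 2 Q)) = zz at *
  generalize ev2 g (MvPolynomial.pderiv 0 (MvPolynomial.pderiv 0 Q)) = xx at *
  linear_combination -a*a*e3 - C g.1*a*a*e2

lemma key_ode (Q W : MvPolynomial (Fin 3) K) (g : K × K × K) (h : ev2 g Q = 0) (hW : HH Q = Q * W)
    (hG : ev2 g (MvPolynomial.pderiv 0 Q) ≠ 0) (F a : K[X]) (hF : F = ev2 g (MvPolynomial.pderiv 1 Q))
    (ha : a = ev2 g (MvPolynomial.pderiv 0 Q)) :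
    a^2 * derivative (derivative F) - 2 * a * derivative a * derivative F
      - F * a * derivative (derivative a) + 2 * F * (derivative a)^2 = 0 := by
  have e1 := chain2 g Q
  have e2 := chain2 g (MvPolynomial.pderiv 0 Q)
  have e3 := chain2 g (MvPolynomial.pderiv 2 Q)
  have e4 := chain2 g (MvPolynomial.pderiv 1 Q)
  have e5 := chain2 g (MvPolynomial.pderiv 0 (MvPolynomial.pderiv 0 Q))
  have e6 := chain2 g (MvPolynomial.pderiv 2 (MvPolynomial.pderiv 0 Q))
  have e7 := chain2 g (MvPolynomial.pderiv 0 (MvPolynomial.pderiv 1 Q))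
  have e8 := chain2 g (MvPolynomial.pderiv 2 (MvPolynomial.pderiv 1 Q))
  rw [h, derivative_zero] at e1
  have e1' : ev2 g (MvPolynomial.pderiv 2 Q) = - (C g.1 * a) := by
    rw [ha]; linear_combination -e1
  rw [pd_comm 0 2] at e3
  rw [e1'] at e3
  simp only [derivative_neg, derivative_mul, derivative_C] at e3
  have w1 : ev2 g (MvPolynomial.pderiv 1 (HH Q)) = F * ev2 g W := by
    rw [hW, MvPolynomial.pderiv_mul, map_add, map_mul, map_mul, h, hF]; ring
  have w0 : ev2 g (MvPolynomial.pderiv 0 (HH Q)) = a * ev2 g W := by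
    rw [hW, MvPolynomial.pderiv_mul, map_add, map_mul, map_mul, h, ha]; ring
  have w : a * ev2 g (MvPolynomial.pderiv 1 (HH Q)) - F * ev2 g (MvPolynomial.pderiv 0 (HH Q)) = 0 := by
    rw [w1, w0]; ring
  simp only [HH, map_add, map_sub, map_mul, MvPolynomial.pderiv_mul, e1', ← ha] at w
  rw [← ha] at hG e2
  rw [← hF] at e4
  -- normalise the order of derivatives
  simp only [pd_comm 1 0, pd_comm 1 2, pd_comm 0 2] at w e2 e3 e4 e5 e6 e7 e8
  have e2' := congrArg derivative e2
  have e4' := congrArg derivative e4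
  simp only [derivative_add, derivative_mul, derivative_C] at e2' e4'
  generalize ev2 g (MvPolynomial.pderiv 0 (MvPolynomial.pderiv 0 Q)) = xx at *
  generalize ev2 g (MvPolynomial.pderiv 2 (MvPolynomial.pderiv 0 Q)) = xz at *
  generalize ev2 g (MvPolynomial.pderiv 2 (MvPolynomial.pderiv 2 Q)) = zz at *
  generalize ev2 g (MvPolynomial.pderiv 0 (MvPolynomial.pderiv 1 Q)) = xy at *
  generalize ev2 g (MvPolynomial.pderiv 2 (MvPolynomial.pderiv 1 Q)) = yz at *
  generalize ev2 g (MvPolynomial.pderiv 0 (MvPolynomial.pderiv 0 (MvPolynomial.pderiv 0 Q))) = xxx at *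
  generalize ev2 g (MvPolynomial.pderiv 2 (MvPolynomial.pderiv 0 (MvPolynomial.pderiv 0 Q))) = xxz at *
  generalize ev2 g (MvPolynomial.pderiv 2 (MvPolynomial.pderiv 2 (MvPolynomial.pderiv 0 Q))) = xzz at *
  generalize ev2 g (MvPolynomial.pderiv 0 (MvPolynomial.pderiv 0 (MvPolynomial.pderiv 1 Q))) = xxy at *
  generalize ev2 g (MvPolynomial.pderiv 2 (MvPolynomial.pderiv 0 (MvPolynomial.pderiv 1 Q))) = xyz at *
  generalize ev2 g (MvPolynomial.pderiv 2 (MvPolynomial.pderiv 2 (MvPolynomial.pderiv 1 Q))) = yzz at *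
  generalize C g.1 = s at *
  generalize derivative (derivative a) = a2 at *
  generalize derivative (derivative F) = F2 at *
  generalize derivative a = a1 at *
  generalize derivative F = F1 at *
  clear w1 w0 hW h
  have hxz : xz = a1 - s * xx := by linear_combination -e2
  have hzz : zz = - 2 * s * a1 + s^2 * xx := by linear_combination -e3 + s * e2
  have hyz : yz = F1 - s * xy := by linear_combination -e4
  have hyzz : yzz = F2 - 2 * s * xyz - s^2 * xxy := by linear_combination -e4' - e8 - s * e7
  have hxzz : xzz = a2 - 2 * s * xxz - s^2 * xxx := by linear_combination -e2' - e6 - s * e5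
  subst hxz hzz hyz hyzz hxzz
  apply mul_left_cancel₀ hG
  rw [mul_zero]
  linear_combination w

end prime
end CT

namespace CT
open scoped Classical
variable {K : Type*} [Field K]
open Polynomial

/-- injective third coordinate -/
def Inj3 (F : Finset (K × K × K)) : Prop := Set.InjOn (fun g => g.2.2) (F : Set (K × K × K))

lemma Inj3.mono {F G : Finset (K × K × K)} (h : Inj3 F) (hG : G ⊆ F) : Inj3 G :=
  Set.InjOn.mono (by exact_mod_cast hG) h

/-- at most `k` points on a line -/
def Col (F : Finset (K × K × K)) (k : ℕ) : Prop :=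
  ∀ α β γ δ : K, (F.filter (fun f => f.1 = α * f.2.2 + β ∧ f.2.1 = γ * f.2.2 + δ)).card ≤ k

lemma Col.mono {F G : Finset (K × K × K)} {k : ℕ} (h : Col F k) (hG : G ⊆ F) : Col G k := by
  intro α β γ δ
  exact (card_le_card (filter_subset_filter _ hG)).trans (h α β γ δ)

lemma affine_ratio (p : ℕ) [CharP K p] (Q : MvPolynomial (Fin 3) K) (hdeg : 3 * Q.totalDegree < p)
    (hd1 : 1 ≤ Q.totalDegree)
    (g : K × K × K) (h : ev2 g Q = 0) (hW : Q ∣ HH Q)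
    (hG : ev2 g (MvPolynomial.pderiv 0 Q) ≠ 0) :
    ∃ c b : K, ev2 g (MvPolynomial.pderiv 1 Q) = (C c * X + C b) * ev2 g (MvPolynomial.pderiv 0 Q) := by
  obtain ⟨W, hW⟩ := hW
  obtain ⟨F, hF⟩ : ∃ F, F = ev2 g (MvPolynomial.pderiv 1 Q) := ⟨_, rfl⟩
  obtain ⟨a, ha⟩ : ∃ a, a = ev2 g (MvPolynomial.pderiv 0 Q) := ⟨_, rfl⟩
  have key := key_ode Q W g h hW hG F a hF ha
  have dF : F.natDegree ≤ Q.totalDegree := by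
    rw [hF]; exact (natDegree_ev2_le _ _).trans ((totalDegree_pderiv _ _).trans (Nat.sub_le _ _))
  have da : a.natDegree ≤ Q.totalDegree := by
    rw [ha]; exact (natDegree_ev2_le _ _).trans ((totalDegree_pderiv _ _).trans (Nat.sub_le _ _))
  have dF' : (derivative F).natDegree ≤ Q.totalDegree := (natDegree_derivative_le F).trans (by omega)
  have da' : (derivative a).natDegree ≤ Q.totalDegree := (natDegree_derivative_le a).trans (by omega)
  rw [← hF, ← ha]
  rw [← ha] at hG
  have m : ∀ x y : K[X], x.natDegree ≤ Q.totalDegree → y.natDegree ≤ Q.totalDegree →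
      (x * y).natDegree ≤ 2 * Q.totalDegree := by
    intro x y hx hy
    have := natDegree_mul_le (p := x) (q := y)
    omega
  obtain ⟨c, hc⟩ := ode p (derivative F * a - F * derivative a) (a * a) (mul_ne_zero hG hG) (by
    simp only [derivative_sub, derivative_mul]
    linear_combination a * key) (by
    refine lt_of_le_of_lt ((natDegree_sub_le _ _).trans (max_le (m _ _ dF' da) (m _ _ dF da'))) ?_
    omega) (lt_of_le_of_lt (m _ _ da da) (by omega))
  obtain ⟨b, hb⟩ := ode p (F - C c * X * a) a hG (by
    simp only [derivative_sub, derivative_mul, derivative_C, derivative_X]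
    linear_combination hc) (by
    refine lt_of_le_of_lt (b := 2 * Q.totalDegree) ((natDegree_sub_le _ _).trans (max_le (by omega) ?_)) (by omega)
    apply m _ _ _ da
    exact (natDegree_C_mul_le c X).trans (by simpa using hd1)) (by omega)
  exact ⟨c, b, by linear_combination hb⟩

/-- the claim -/
def Cl (F1 F2 : Finset (K × K × K)) (k : ℕ) (P : MvPolynomial (Fin 3) K) : Prop :=
  ∃ Bad ⊆ F2, Bad.card ≤ 6 * P.totalDegree ^ 2 ∧ ∀ g ∈ F2, ev2 g P = 0 → g ∉ Bad →
    (F1.filter (fun f => ev1 f P = 0 ∧ Inc f g)).card ≤ P.totalDegree + k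

lemma totalDegree_pos_of_irred (Q : MvPolynomial (Fin 3) K) (hQ : Irreducible Q) : 1 ≤ Q.totalDegree := by
  by_contra h
  have h0 : Q.totalDegree = 0 := by omega
  rw [MvPolynomial.totalDegree_eq_zero_iff_eq_C] at h0
  have : Q.coeff 0 ≠ 0 := by
    intro h1
    rw [h1, map_zero] at h0
    exact hQ.ne_zero h0
  apply hQ.not_isUnit
  rw [h0]
  exact (isUnit_iff_ne_zero.2 this).map MvPolynomial.C

lemma cl_prime (p : ℕ) [CharP K p] (F1 F2 : Finset (K × K × K)) (h1 : Inj3 F1) (h2 : Inj3 F2) (k : ℕ)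
    (hk : Col F1 k) (Q : MvPolynomial (Fin 3) K) (hQ : Irreducible Q) (hdeg : 3 * Q.totalDegree < p) :
    Cl F1 F2 k Q := by
  have hd1 := totalDegree_pos_of_irred Q hQ
  by_cases hd : Q.degreeOf 0 = 0
  · refine ⟨F2.filter (fun g => ev2 g Q = 0), filter_subset _ _, ?_, ?_⟩
    · have := low_deg Q hQ.ne_zero hd (F2.filter (fun g => ev2 g Q = 0)) (h2.mono (filter_subset _ _))
        (by intro g hg; exact (mem_filter.1 hg).2)
      nlinarith
    · intro g hg h h'
      exact absurd (mem_filter.2 ⟨hg, h⟩) h'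
  by_cases hH : Q ∣ HH Q
  swap
  · refine ⟨F2.filter (fun g => ev2 g Q = 0), filter_subset _ _, ?_, ?_⟩
    · have := bezout Q (HH Q) hQ hd hH (F2.filter (fun g => ev2 g Q = 0)) (h2.mono (filter_subset _ _))
        (by intro g hg; exact (mem_filter.1 hg).2)
        (by intro g hg; exact HH_vanish _ _ (mem_filter.1 hg).2)
      have := HH_deg Q
      nlinarith
    · intro g hg h h'
      exact absurd (mem_filter.2 ⟨hg, h⟩) h'
  have hdx : Q.degreeOf 0 < p := by
    have := MvPolynomial.degreeOf_le_totalDegree Q 0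
    omega
  have hQX := pderiv_ne_zero p Q hd hdx
  have hnd : ¬ Q ∣ MvPolynomial.pderiv 0 Q := by
    intro h
    obtain ⟨W, hW⟩ := h
    have hW0 : W ≠ 0 := by rintro rfl; simp [hW] at hQX
    have e := MvPolynomial.totalDegree_mul_of_isDomain hQ.ne_zero hW0
    rw [← hW] at e
    have := totalDegree_pderiv 0 Q
    omega
  refine ⟨F2.filter (fun g => ev2 g Q = 0 ∧ ev2 g (MvPolynomial.pderiv 0 Q) = 0), filter_subset _ _, ?_, ?_⟩
  · have := bezout Q _ hQ hd hnd (F2.filter (fun g => ev2 g Q = 0 ∧ ev2 g (MvPolynomial.pderiv 0 Q) = 0)) (h2.mono (filter_subset _ _))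
        (by intro g hg; exact (mem_filter.1 hg).2.1)
        (by intro g hg; exact (mem_filter.1 hg).2.2)
    have := (totalDegree_pderiv 0 Q).trans (Nat.sub_le _ _)
    nlinarith
  · intro g hg h h'
    have hG : ev2 g (MvPolynomial.pderiv 0 Q) ≠ 0 := by
      intro h3; exact h' (mem_filter.2 ⟨hg, h, h3⟩)
    obtain ⟨c, b, hcb⟩ := affine_ratio p Q hdeg hd1 g h hH hG
    have hsub : F1.filter (fun f => ev1 f Q = 0 ∧ Inc f g) ⊆
        F1.filter (fun f => (ev2 g (MvPolynomial.pderiv 0 Q)).eval f.2.2 = 0) ∪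
        F1.filter (fun f => f.1 = (-c) * f.2.2 + (-b) ∧ f.2.1 = (g.1 + c * g.2.2) * f.2.2 + (g.2.1 + b * g.2.2)) := by
      intro f hf
      rw [mem_filter] at hf
      obtain ⟨hf1, hf2, hf3⟩ := hf
      rw [mem_union, mem_filter, mem_filter]
      have c1 := chain1 f Q
      rw [hf2, derivative_zero] at c1
      have c2 := congrArg (Polynomial.eval g.2.2) c1
      rw [eval_zero, eval_add, eval_mul, eval_C, ← ev_inc f g hf3, ← ev_inc f g hf3, hcb, eval_mul] at c2
      simp only [eval_add, eval_mul, eval_C, eval_X] at c2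
      by_cases h0 : (ev2 g (MvPolynomial.pderiv 0 Q)).eval f.2.2 = 0
      · exact Or.inl ⟨hf1, h0⟩
      · right
        have c3 : f.1 = (-c) * f.2.2 + (-b) := by
          apply mul_right_cancel₀ h0
          linear_combination -c2
        refine ⟨hf1, c3, ?_⟩
        unfold Inc at hf3
        rw [c3] at hf3
        linear_combination hf3
    refine (card_le_card hsub).trans ((card_union_le _ _).trans (Nat.add_le_add ?_ (hk _ _ _ _)))
    refine (root_count F1 h1 _ hG).trans ((natDegree_ev2_le _ _).trans ((totalDegree_pderiv _ _).trans (Nat.sub_le _ _)))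

lemma other_factor (F1 : Finset (K × K × K)) (h1 : Inj3 F1) (g : K × K × K) (R : MvPolynomial (Fin 3) K)
    (hR : ev2 g R ≠ 0) : (F1.filter (fun f => ev1 f R = 0 ∧ Inc f g)).card ≤ R.totalDegree := by
  refine le_trans (card_le_card ?_) ((root_count F1 h1 _ hR).trans (natDegree_ev2_le _ _))
  intro f hf
  rw [mem_filter] at hf ⊢
  refine ⟨hf.1, ?_⟩
  rw [ev_inc f g hf.2.2, hf.2.1, eval_zero]

lemma cl_mul (p : ℕ) [CharP K p] (F1 F2 : Finset (K × K × K)) (h1 : Inj3 F1) (h2 : Inj3 F2) (k : ℕ)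
    (hk : Col F1 k) (Q R : MvPolynomial (Fin 3) K) (hQ : Irreducible Q) (hR0 : R ≠ 0) (hdeg : 3 * (Q * R).totalDegree < p)
    (hR : Cl F1 F2 k R) : Cl F1 F2 k (Q * R) := by
  have hd1 := totalDegree_pos_of_irred Q hQ
  have e := MvPolynomial.totalDegree_mul_of_isDomain hQ.ne_zero hR0
  have hc := cl_prime p F1 F2 h1 h2 k hk Q hQ (by omega)
  have ev1m : ∀ f, ev1 f (Q * R) = 0 ↔ ev1 f Q = 0 ∨ ev1 f R = 0 := by
    intro f; rw [map_mul, mul_eq_zero]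
  have ev2m : ∀ f, ev2 f (Q * R) = 0 ↔ ev2 f Q = 0 ∨ ev2 f R = 0 := by
    intro f; rw [map_mul, mul_eq_zero]
  unfold Cl at *
  rw [e]
  by_cases hdv : Q ∣ R
  · obtain ⟨B, hB, hB1, hB2⟩ := hR
    have d1 : ∀ f, ev1 f Q = 0 → ev1 f R = 0 := by
      intro f hf; obtain ⟨W, rfl⟩ := hdv; rw [map_mul, hf, zero_mul]
    have d2 : ∀ f, ev2 f Q = 0 → ev2 f R = 0 := by
      intro f hf; obtain ⟨W, rfl⟩ := hdv; rw [map_mul, hf, zero_mul]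
    refine ⟨B, hB, by nlinarith, ?_⟩
    intro g hg h h'
    rw [ev2m] at h
    have hh := hB2 g hg (h.elim (d2 g) id) h'
    refine (card_le_card ?_).trans (hh.trans (by omega))
    intro f hf
    rw [mem_filter, ev1m] at hf
    rw [mem_filter]
    exact ⟨hf.1, hf.2.1.elim (d1 f) id, hf.2.2⟩
  obtain ⟨B, hB, hB1, hB2⟩ := hR
  obtain ⟨B', hB', hB1', hB2'⟩ := hc
  have hbb : (F2.filter (fun g => ev2 g Q = 0 ∧ ev2 g R = 0)).card ≤ 2 * (Q.totalDegree * R.totalDegree) := by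
    by_cases hd : Q.degreeOf 0 = 0
    · by_cases hdR : R.totalDegree = 0
      · rw [MvPolynomial.totalDegree_eq_zero_iff_eq_C] at hdR
        have hcf : R.coeff 0 ≠ 0 := by
          intro h1
          rw [h1, map_zero] at hdR
          exact hR0 hdR
        have : F2.filter (fun g => ev2 g Q = 0 ∧ ev2 g R = 0) = ∅ := by
          apply filter_false_of_mem
          rintro g - ⟨-, h⟩
          rw [hdR] at h
          apply hcf
          simpa [ev2] using h
        rw [this]; simp
      · have := low_deg Q hQ.ne_zero hd (F2.filter (fun g => ev2 g Q = 0 ∧ ev2 g R = 0)) (h2.mono (filter_subset _ _))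
          (by intro g hg; exact (mem_filter.1 hg).2.1)
        have : 1 ≤ R.totalDegree := by omega
        nlinarith
    · exact bezout Q R hQ hd hdv _ (h2.mono (filter_subset _ _))
        (by intro g hg; exact (mem_filter.1 hg).2.1)
        (by intro g hg; exact (mem_filter.1 hg).2.2)
  refine ⟨B ∪ B' ∪ F2.filter (fun g => ev2 g Q = 0 ∧ ev2 g R = 0),
    union_subset (union_subset hB hB') (filter_subset _ _), ?_, ?_⟩
  · have := card_union_le (B ∪ B') (F2.filter (fun g => ev2 g Q = 0 ∧ ev2 g R = 0))
    have := card_union_le B B'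
    nlinarith
  · intro g hg h h'
    rw [mem_union, mem_union, mem_filter] at h'
    push Not at h'
    have hs : F1.filter (fun f => ev1 f (Q * R) = 0 ∧ Inc f g) ⊆
        F1.filter (fun f => ev1 f Q = 0 ∧ Inc f g) ∪ F1.filter (fun f => ev1 f R = 0 ∧ Inc f g) := by
      intro f hf
      simp only [mem_filter, mem_union, ev1m] at hf ⊢
      tauto
    refine (card_le_card hs).trans ((card_union_le _ _).trans ?_)
    by_cases hq : ev2 g Q = 0
    · have hr := h'.2 hg hq
      have a1 := other_factor F1 h1 g R hr
      have a2 := hB2' g hg hq h'.1.2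
      omega
    · have hr : ev2 g R = 0 := by
        rw [ev2m] at h; tauto
      have a1 := other_factor F1 h1 g Q hq
      have a2 := hB2 g hg hr h'.1.1
      omega

lemma cl_all (p : ℕ) [CharP K p] (F1 F2 : Finset (K × K × K)) (h1 : Inj3 F1) (h2 : Inj3 F2) (k : ℕ)
    (hk : Col F1 k) (P : MvPolynomial (Fin 3) K) : P ≠ 0 → 3 * P.totalDegree < p → Cl F1 F2 k P := by
  induction P using UniqueFactorizationMonoid.induction_on_prime with
  | h₁ => intro h; exact absurd rfl h
  | h₂ x hx =>
    intro h0 _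
    refine ⟨∅, empty_subset _, by simp, ?_⟩
    intro g hg h
    exact absurd h (hx.map (ev2 g)).ne_zero
  | h₃ a q ha hq ih =>
    intro h0 hd
    have e := MvPolynomial.totalDegree_mul_of_isDomain hq.ne_zero ha
    exact cl_mul p F1 F2 h1 h2 k hk q a hq.irreducible ha hd (ih ha (by omega))

end CT

namespace CT
open scoped Classical
variable {K : Type*} [Field K]
open Polynomial

lemma exists_poly (F : Finset (K × K × K)) (d : ℕ) (hd : 2 * F.card < d ^ 2) :
    ∃ P : MvPolynomial (Fin 3) K, P ≠ 0 ∧ P.totalDegree ≤ 3 * d ∧ ∀ f ∈ F, ev1 f P = 0 := by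
  have hd0 : 0 < d := by
    rcases Nat.eq_zero_or_pos d with h | h
    · simp [h] at hd
    · exact h
  let e : (Fin d × Fin d × Fin d) → (Fin 3 →₀ ℕ) := fun x =>
    Finsupp.equivFunOnFinite.symm ![(x.1 : ℕ), (x.2.1 : ℕ), (x.2.2 : ℕ)]
  have he : Function.Injective e := by
    intro x y hxy
    have h := Finsupp.equivFunOnFinite.symm.injective hxy
    have h0 := congrFun h 0
    have h1 := congrFun h 1
    have h2 := congrFun h 2
    simp at h0 h1 h2
    ext <;> simp [h0, h1, h2]
  have hli : LinearIndependent K (fun x => MvPolynomial.monomial (e x) (1 : K)) := by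
    have := (MvPolynomial.basisMonomials (Fin 3) K).linearIndependent.comp e he
    simpa [Function.comp_def] using this
  let L : (Fin d × Fin d × Fin d → K) →ₗ[K] MvPolynomial (Fin 3) K :=
    Fintype.linearCombination K (fun x => MvPolynomial.monomial (e x) (1 : K))
  have hL : Function.Injective L := by
    rw [injective_iff_map_eq_zero]
    intro c hc
    funext x
    exact Fintype.linearIndependent_iff.1 hli c (by simpa [L, Fintype.linearCombination_apply] using hc) x
  let M : (Fin d × Fin d × Fin d → K) →ₗ[K] (F × Fin (2 * d) → K) :=
    LinearMap.pi (fun x => (Polynomial.lcoeff K (x.2 : ℕ)).comp ((ev1 x.1.1).toLinearMap.comp L))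
  have hM : LinearMap.ker M ≠ ⊥ := by
    apply LinearMap.ker_ne_bot_of_finrank_lt
    simp only [Module.finrank_fintype_fun_eq_card, Fintype.card_prod, Fintype.card_fin, Fintype.card_coe]
    nlinarith
  obtain ⟨c, hc, hc0⟩ := Submodule.exists_mem_ne_zero_of_ne_bot hM
  have hLc : L c = ∑ x, c x • MvPolynomial.monomial (e x) (1 : K) := by
    simp [L, Fintype.linearCombination_apply]
  refine ⟨L c, ?_, ?_, ?_⟩
  · intro h
    apply hc0
    apply hL
    rw [h, map_zero]
  · rw [hLc]
    apply MvPolynomial.totalDegree_finsetSum_le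
    intro x _
    refine (MvPolynomial.totalDegree_smul_le _ _).trans ?_
    refine (MvPolynomial.totalDegree_monomial_le _ _).trans ?_
    have h1 := x.1.2
    have h2 := x.2.1.2
    have h3 := x.2.2.2
    rw [Finsupp.sum_fintype _ _ (by simp), Fin.sum_univ_three]
    simp [e]
    omega
  · intro f hf
    ext n
    rw [coeff_zero]
    by_cases hn : n < 2 * d
    · have := congrFun hc (⟨f, hf⟩, ⟨n, hn⟩)
      simpa [M] using this
    · apply coeff_eq_zero_of_natDegree_lt
      rw [hLc, map_sum]
      refine lt_of_le_of_lt (b := 2 * d - 1) ?_ (by omega)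
      apply natDegree_sum_le_of_forall_le
      intro x _
      rw [map_smul]
      refine (natDegree_smul_le _ _).trans ?_
      have h1 := x.1.2
      have h2 := x.2.1.2
      have h3 : ev1 f (MvPolynomial.monomial (e x) (1:K)) = (C f.1 * X + C f.2.1) ^ (x.1 : ℕ) * X ^ (x.2.1 : ℕ) * C (f.2.2 ^ (x.2.2 : ℕ)) := by
        rw [ev1, MvPolynomial.aeval_monomial, Finsupp.prod_fintype _ _ (by simp), Fin.prod_univ_three]
        simp [e]
      rw [h3]
      refine (natDegree_mul_C_le _ _).trans (natDegree_mul_le.trans ?_)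
      have h4 : (C f.1 * X + C f.2.1 : K[X]).natDegree ≤ 1 := by compute_degree
      have h5 := natDegree_pow_le_of_le (x.1 : ℕ) h4
      rw [natDegree_X_pow]
      omega

/-- number of incidences -/
noncomputable def II (F G : Finset (K × K × K)) : ℕ := ∑ g ∈ G, (F.filter (fun f => Inc f g)).card

lemma II_comm (F G : Finset (K × K × K)) : II F G = II G F := by
  unfold II
  simp only [card_filter]
  rw [sum_comm]
  apply sum_congr rfl
  intro f _
  apply sum_congr rfl
  intro g _
  simp only [inc_comm f g]

lemma II_mono {F G F' G' : Finset (K × K × K)} (h : F ⊆ F') (h' : G ⊆ G') : II F G ≤ II F' G' := by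
  unfold II
  refine (sum_le_sum_of_subset h').trans (sum_le_sum ?_)
  intro g _
  exact card_le_card (filter_subset_filter _ h)

lemma II_trivial (F G : Finset (K × K × K)) : II F G ≤ F.card * G.card := by
  unfold II
  refine (sum_le_card_nsmul _ _ F.card ?_).trans (by rw [smul_eq_mul, mul_comm])
  intro g _
  exact card_filter_le _ _

lemma II_union (F G G' : Finset (K × K × K)) : II F (G ∪ G') ≤ II F G + II F G' := by
  unfold II
  rw [← sum_union_inter]
  omega

lemma lemmaS (p : ℕ) [CharP K p] (F1 F2 F1' : Finset (K × K × K)) (h1 : Inj3 F1) (h2 : Inj3 F2) (k : ℕ)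
    (hk : Col F1 k) (d : ℕ) (hdp : 9 * d < p) (hF : F1' ⊆ F1) (hd : 2 * F1'.card < d ^ 2) :
    ∃ F2s ⊆ F2, ∃ Bad ⊆ F2, Bad.card ≤ 54 * d ^ 2 ∧
      (∀ g ∈ F2, 3 * d < (F1'.filter (fun f => Inc f g)).card → g ∈ F2s) ∧
      II F1 F2s ≤ 3 * d * F1.card + (3 * d + k) * F2.card + II F1 Bad := by
  obtain ⟨P, hP0, hPd, hP⟩ := exists_poly F1' d hd
  obtain ⟨Bad, hB, hB1, hB2⟩ := cl_all p F1 F2 h1 h2 k hk P hP0 (by omega)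
  refine ⟨F2.filter (fun g => ev2 g P = 0), filter_subset _ _, Bad, hB, by nlinarith, ?_, ?_⟩
  · intro g hg hh
    rw [mem_filter]
    refine ⟨hg, ?_⟩
    by_contra h0
    have h3 := other_factor F1' (h1.mono hF) g P h0
    have h4 : F1'.filter (fun f => Inc f g) ⊆ F1'.filter (fun f => ev1 f P = 0 ∧ Inc f g) := by
      intro f hf
      rw [mem_filter] at hf ⊢
      exact ⟨hf.1, hP f hf.1, hf.2⟩
    have := card_le_card h4
    omega
  · set F2s := F2.filter (fun g => ev2 g P = 0) with hF2s
    have hs : II F1 F2s ≤ II F1 (F2s \ Bad) + II F1 Bad := by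
      refine (II_mono (le_refl F1) ?_).trans (II_union _ _ _)
      intro g hg
      rw [mem_union, mem_sdiff]; tauto
    refine hs.trans (Nat.add_le_add_right ?_ _)
    have hsp : II F1 (F2s \ Bad) ≤ II (F1.filter (fun f => ¬ ev1 f P = 0)) F2s +
        ∑ g ∈ F2s \ Bad, (F1.filter (fun f => ev1 f P = 0 ∧ Inc f g)).card := by
      refine le_trans ?_ (Nat.add_le_add_right (II_mono (le_refl _) (sdiff_subset (t := Bad))) _)
      unfold II
      rw [← sum_add_distrib]
      apply sum_le_sum
      intro g _
      refine (card_le_card ?_).trans (card_union_le _ _)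
      intro f hf
      simp only [mem_union, mem_filter] at hf ⊢
      tauto
    refine hsp.trans (Nat.add_le_add ?_ ?_)
    · rw [II_comm]
      unfold II
      refine (sum_le_card_nsmul _ _ (3 * d) ?_).trans ?_
      · intro f hf
        rw [mem_filter] at hf
        refine le_trans (card_le_card ?_) ((root_count F2 h2 _ hf.2).trans ((natDegree_ev1_le _ _).trans hPd))
        intro g hg
        rw [mem_filter, hF2s, mem_filter] at hg
        rw [mem_filter]
        refine ⟨hg.1.1, ?_⟩
        rw [← ev_inc f g ((inc_comm _ _).1 hg.2), hg.1.2, eval_zero]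
      · rw [smul_eq_mul, mul_comm]
        exact Nat.mul_le_mul_left _ (card_filter_le _ _)
    · refine (sum_le_card_nsmul _ _ (3 * d + k) ?_).trans ?_
      · intro g hg
        rw [mem_sdiff, hF2s, mem_filter] at hg
        have := hB2 g hg.1.1 hg.1.2 hg.2
        omega
      · rw [smul_eq_mul, mul_comm]
        exact Nat.mul_le_mul_left _ (card_le_card (sdiff_subset.trans (filter_subset _ _)))

end CT

namespace CT
open scoped Classical

lemma sampling {α β : Type*} (J : Finset β) (S : β → α → Prop) (w : β → ℝ) (q lam : ℝ)
    (hq0 : 0 ≤ q) (hq1 : q ≤ 1) (U : Finset α) :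
    ∃ T ⊆ U, ∑ j ∈ J, w j * (((T.filter (S j)).card : ℝ) - q * (U.filter (S j)).card) ^ 2 + lam * T.card
      ≤ ∑ j ∈ J, w j * (q * (1 - q) * (U.filter (S j)).card) + lam * q * U.card := by
  induction U using Finset.induction_on with
  | empty => exact ⟨∅, by simp, by simp⟩
  | insert x U hx ih =>
    obtain ⟨T, hT, h⟩ := ih
    have hxT : x ∉ T := fun h => hx (hT h)
    let a : β → ℝ := fun j => if S j x then 1 else 0
    have ha : ∀ j, a j * a j = a j := by intro j; simp only [a]; split_ifs <;> simp
    have hU : ∀ j, (((insert x U).filter (S j)).card : ℝ) = (U.filter (S j)).card + a j := by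
      intro j
      rw [filter_insert]
      simp only [a]
      split_ifs with h
      · rw [card_insert_of_notMem (by simp [hx])]; push_cast; ring
      · simp
    have hTT : ∀ j, (((insert x T).filter (S j)).card : ℝ) = (T.filter (S j)).card + a j := by
      intro j
      rw [filter_insert]
      simp only [a]
      split_ifs with h
      · rw [card_insert_of_notMem (by simp [hxT])]; push_cast; ring
      · simp
    simp only [hU, card_insert_of_notMem hx]
    set c0 := ∑ j ∈ J, w j * (((T.filter (S j)).card : ℝ) - q * ((U.filter (S j)).card + a j)) ^ 2 + lam * T.card with hc0
    set c1 := ∑ j ∈ J, w j * ((((T.filter (S j)).card : ℝ) + a j) - q * ((U.filter (S j)).card + a j)) ^ 2 + lam * (T.card + 1) with hc1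
    have havg : (1 - q) * c0 + q * c1 = ∑ j ∈ J, w j * (((T.filter (S j)).card : ℝ) - q * (U.filter (S j)).card) ^ 2 + lam * T.card
        + (∑ j ∈ J, w j * (q * (1 - q) * a j) + lam * q) := by
      rw [hc0, hc1, mul_add, mul_add, mul_sum, mul_sum]
      have : ∑ j ∈ J, (1 - q) * (w j * (((T.filter (S j)).card : ℝ) - q * ((U.filter (S j)).card + a j)) ^ 2)
         + ∑ j ∈ J, q * (w j * ((((T.filter (S j)).card : ℝ) + a j) - q * ((U.filter (S j)).card + a j)) ^ 2)
         = ∑ j ∈ J, w j * (((T.filter (S j)).card : ℝ) - q * (U.filter (S j)).card) ^ 2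
           + ∑ j ∈ J, w j * (q * (1 - q) * a j) := by
        rw [← sum_add_distrib, ← sum_add_distrib]
        apply sum_congr rfl
        intro j _
        linear_combination (w j * q * (1 - q)) * ha j
      linear_combination this
    have hR : ∑ j ∈ J, w j * (q * (1 - q) * ((U.filter (S j)).card + a j)) + lam * q * ((U.card + 1 : ℕ) : ℝ)
        = (∑ j ∈ J, w j * (q * (1 - q) * (U.filter (S j)).card) + lam * q * U.card) + (∑ j ∈ J, w j * (q * (1 - q) * a j) + lam * q) := by
      have : ∑ j ∈ J, w j * (q * (1 - q) * (((U.filter (S j)).card : ℝ) + a j)) = 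
         ∑ j ∈ J, w j * (q * (1 - q) * (U.filter (S j)).card) + ∑ j ∈ J, w j * (q * (1 - q) * a j) := by
        rw [← sum_add_distrib]
        apply sum_congr rfl
        intro j _
        ring
      rw [this]; push_cast; ring
    rw [hR]
    by_cases hc : c0 ≤ c1
    · refine ⟨T, hT.trans (subset_insert _ _), ?_⟩
      have : c0 ≤ (1 - q) * c0 + q * c1 := by nlinarith
      linarith
    · refine ⟨insert x T, insert_subset_insert _ hT, ?_⟩
      simp only [hTT, card_insert_of_notMem hxT]
      have : c1 ≤ (1 - q) * c0 + q * c1 := by nlinarith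
      push_cast
      linarith

lemma sample_aux {β : Type*} (J : Finset β) (n t : β → ℝ) (q u c W : ℝ)
    (hq0 : 0 < q) (hu : 0 < u) (hc : 0 ≤ c) (hnpos : ∀ j ∈ J, 0 < n j) (hn : ∀ j ∈ J, 16 / q ≤ n j)
    (hW : W = ∑ j ∈ J, n j) (hWpos : 0 < W)
    (h : ∑ j ∈ J, 4 / (q ^ 2 * n j) * (t j - q * n j) ^ 2 + W / (4 * q * u) * c
      ≤ ∑ j ∈ J, 4 / (q ^ 2 * n j) * (q * (1 - q) * n j) + W / (4 * q * u) * q * u) :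
    c ≤ 2 * q * u ∧ ∑ j ∈ J, n j ≤ 2 * ∑ j ∈ J.filter (fun j => q * n j / 2 ≤ t j), n j := by
  have hR : ∑ j ∈ J, (4 / (q ^ 2 * n j)) * (q * (1 - q) * n j) + W / (4 * q * u) * q * u ≤ W / 2 := by
    have h1 : ∑ j ∈ J, (4 / (q ^ 2 * n j)) * (q * (1 - q) * n j) ≤ ∑ j ∈ J, n j / 4 := by
      apply sum_le_sum
      intro j hj
      have h0 := hnpos j hj
      have e : (4 / (q ^ 2 * n j)) * (q * (1 - q) * n j) = 4 * (1 - q) / q := by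
        field_simp
      rw [e]
      have h3 := hn j hj
      have : 4 * (1 - q) / q ≤ 4 / q := by
        apply div_le_div_of_nonneg_right _ hq0.le
        linarith
      have : 4 / q = (16 / q) / 4 := by ring
      linarith
    rw [← sum_div, ← hW] at h1
    have e2 : W / (4 * q * u) * q * u = W / 4 := by field_simp
    rw [e2]; linarith
  have h' := h.trans hR
  have hS0 : 0 ≤ ∑ j ∈ J, (4 / (q ^ 2 * n j)) * (t j - q * n j) ^ 2 := by
    apply sum_nonneg
    intro j hj
    have := hnpos j hj
    positivity
  have hT0 : 0 ≤ W / (4 * q * u) * c := by positivity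
  refine ⟨?_, ?_⟩
  · have h2 : W / (4 * q * u) * c ≤ W / 2 := by linarith
    rw [div_mul_eq_mul_div, div_le_div_iff₀ (by positivity) (by positivity)] at h2
    have : W * (c * 2) ≤ W * (4 * q * u) := by linarith
    have := le_of_mul_le_mul_left this hWpos
    linarith
  · have h2 : ∑ j ∈ J.filter (fun j => ¬ q * n j / 2 ≤ t j), n j ≤ W / 2 := by
      refine le_trans ?_ (show _ ≤ W / 2 from le_trans (le_add_of_nonneg_right hT0) h')
      refine le_trans (sum_le_sum ?_) (sum_le_sum_of_subset_of_nonneg (filter_subset _ _) ?_)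
      · intro j hj
        rw [mem_filter] at hj
        have h0 := hnpos j hj.1
        rw [div_mul_eq_mul_div, le_div_iff₀ (by positivity)]
        have h5 : q * n j / 2 ≤ q * n j - t j := by linarith [not_le.1 hj.2]
        have h6 : 0 ≤ q * n j / 2 := by positivity
        nlinarith
      · intro j hj _
        have := hnpos j hj
        positivity
    have h3 := sum_filter_add_sum_filter_not J (fun j => q * n j / 2 ≤ t j) n
    rw [← hW] at h3 ⊢
    linarith

lemma sample {α β : Type*} (J : Finset β) (S : β → α → Prop) (q : ℝ)
    (hq0 : 0 < q) (hq1 : q ≤ 1) (U : Finset α)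
    (hn : ∀ j ∈ J, 16 / q ≤ ((U.filter (S j)).card : ℝ)) :
    ∃ T ⊆ U, (T.card : ℝ) ≤ 2 * q * U.card ∧
      ∑ j ∈ J, ((U.filter (S j)).card : ℝ) ≤
       2 * ∑ j ∈ J.filter (fun j => q * ((U.filter (S j)).card : ℝ) / 2 ≤ ((T.filter (S j)).card : ℝ)),
          ((U.filter (S j)).card : ℝ) := by
  rcases J.eq_empty_or_nonempty with rfl | ⟨j0, hj0⟩
  · exact ⟨∅, by simp, by simp; positivity, by simp⟩
  have hnpos : ∀ j ∈ J, 0 < ((U.filter (S j)).card : ℝ) := fun j hj => lt_of_lt_of_le (by positivity) (hn j hj)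
  have hWpos : 0 < ∑ j ∈ J, ((U.filter (S j)).card : ℝ) := sum_pos hnpos ⟨j0, hj0⟩
  have hU : 0 < (U.card : ℝ) := by
    refine lt_of_lt_of_le (hnpos j0 hj0) ?_
    exact_mod_cast card_filter_le _ _
  obtain ⟨T, hT, h⟩ := sampling J S (fun j => 4 / (q ^ 2 * ((U.filter (S j)).card : ℝ))) q
    ((∑ j ∈ J, ((U.filter (S j)).card : ℝ)) / (4 * q * U.card)) hq0.le hq1 U
  exact ⟨T, hT, sample_aux J (fun j => ((U.filter (S j)).card : ℝ)) (fun j => ((T.filter (S j)).card : ℝ)) q U.card T.card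
    _ hq0 hU (by positivity) hnpos hn rfl hWpos h⟩

variable {K : Type*} [Field K]

lemma step_split (s q : ℝ) (hs : 0 ≤ s) (hq : q = 1 / 1000000) (F1 F2 F2s T J : Finset (K × K × K)) (d : ℕ)
    (hd2 : (d : ℝ) ≤ 0.003 * s) (hs0 : 0 < s)
    (hrich : ∀ g ∈ F2, 3 * d < (T.filter (fun f => Inc f g)).card → g ∈ F2s)
    (n2 : (F2.card : ℝ) ≤ s ^ 2)
    (hJ : J = F2.filter (fun g => 20000 * s ≤ ((F1.filter (fun f => Inc f g)).card : ℝ)))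
    (hTs : ∑ j ∈ J, ((F1.filter (fun f => Inc f j)).card : ℝ) ≤
       2 * ∑ j ∈ J.filter (fun j => q * ((F1.filter (fun f => Inc f j)).card : ℝ) / 2 ≤ ((T.filter (fun f => Inc f j)).card : ℝ)),
          ((F1.filter (fun f => Inc f j)).card : ℝ)) :
    (II F1 F2 : ℝ) ≤ 20000 * s ^ 3 + 2 * II F1 F2s := by
  have e : (II F1 F2 : ℝ) = ∑ g ∈ J, ((F1.filter (fun f => Inc f g)).card : ℝ) +
     ∑ g ∈ F2.filter (fun g => ¬ 20000 * s ≤ ((F1.filter (fun f => Inc f g)).card : ℝ)), ((F1.filter (fun f => Inc f g)).card : ℝ) := by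
    unfold II
    push_cast
    rw [hJ, sum_filter_add_sum_filter_not]
  have e1 : ∑ g ∈ F2.filter (fun g => ¬ 20000 * s ≤ ((F1.filter (fun f => Inc f g)).card : ℝ)), ((F1.filter (fun f => Inc f g)).card : ℝ) ≤ 20000 * s ^ 3 := by
    refine (sum_le_card_nsmul _ _ (20000 * s) ?_).trans ?_
    · intro g hg
      rw [mem_filter] at hg
      exact (not_le.1 hg.2).le
    · rw [nsmul_eq_mul]
      have : ((F2.filter (fun g => ¬ 20000 * s ≤ ((F1.filter (fun f => Inc f g)).card : ℝ))).card : ℝ) ≤ s ^ 2 := by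
        refine le_trans ?_ n2
        exact_mod_cast card_filter_le _ _
      have : 0 ≤ 20000 * s := by positivity
      nlinarith
  have e2 : ∑ j ∈ J.filter (fun j => q * ((F1.filter (fun f => Inc f j)).card : ℝ) / 2 ≤ ((T.filter (fun f => Inc f j)).card : ℝ)),
        ((F1.filter (fun f => Inc f j)).card : ℝ) ≤ II F1 F2s := by
    unfold II
    push_cast
    apply sum_le_sum_of_subset_of_nonneg
    · intro g hg
      rw [mem_filter, hJ, mem_filter] at hg
      apply hrich g hg.1.1
      have h3 := hg.2
      have h4 := hg.1.2
      rw [hq] at h3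
      have : (3 * d : ℝ) < ((T.filter (fun f => Inc f g)).card : ℝ) := by linarith
      exact_mod_cast this
    · intros; positivity
  linarith

theorem incidence_step (p : ℕ) [CharP K p] (k : ℕ) (s : ℝ) (hs : 1000 ≤ s) (hsp : s ≤ p)
    (F1 F2 : Finset (K × K × K)) (h1 : Inj3 F1) (h2 : Inj3 F2) (c1 : Col F1 k) (c2 : Col F2 k)
    (n1 : (F1.card : ℝ) ≤ s ^ 2) (n2 : (F2.card : ℝ) ≤ s ^ 2) :
    ∃ G1 ⊆ F1, ∃ G2 ⊆ F2, (G1.card : ℝ) ≤ (s/2) ^ 2 ∧ (G2.card : ℝ) ≤ (s/2) ^ 2 ∧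
     (II F1 F2 : ℝ) ≤ 20001 * s ^ 3 + 4 * k * s ^ 2 + 2 * II G2 G1 := by
  set q : ℝ := 1 / 1000000 with hq
  set J := F2.filter (fun g => 20000 * s ≤ ((F1.filter (fun f => Inc f g)).card : ℝ)) with hJ
  obtain ⟨T, hT, hTc, hTs⟩ := sample J (fun g f => Inc f g) q (by norm_num [hq]) (by norm_num [hq]) F1 (by
    intro j hj
    rw [hJ, mem_filter] at hj
    refine le_trans ?_ hj.2
    norm_num [hq]; linarith)
  -- the degree
  set d := Nat.sqrt (2 * T.card) + 1 with hd
  have hd1 : 2 * T.card < d ^ 2 := by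
    have := Nat.lt_succ_sqrt' (2 * T.card)
    simpa [hd] using this
  have hd2 : (d : ℝ) ≤ 0.003 * s := by
    have e1 : (Nat.sqrt (2 * T.card) : ℝ) ^ 2 ≤ (0.002 * s) ^ 2 := by
      have : (Nat.sqrt (2 * T.card) : ℝ) ^ 2 ≤ 2 * T.card := by
        exact_mod_cast Nat.sqrt_le' (2 * T.card)
      rw [hq] at hTc
      nlinarith
    have e2 := abs_le_of_sq_le_sq e1 (by positivity)
    rw [hd]; push_cast
    linarith [le_abs_self (Nat.sqrt (2 * T.card) : ℝ)]
  have hdp : 9 * d < p := by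
    have : (9 * d : ℝ) < p := by linarith
    exact_mod_cast this
  obtain ⟨F2s, hF2s, Bad, hBad, hBc, hrich, hI⟩ := lemmaS p F1 F2 T h1 h2 k c1 d hdp hT hd1
  have hBc' : (Bad.card : ℝ) ≤ 0.000486 * s ^ 2 := by
    have : (Bad.card : ℝ) ≤ 54 * (d : ℝ) ^ 2 := by exact_mod_cast hBc
    have : (d : ℝ) ^ 2 ≤ (0.003 * s) ^ 2 := by gcongr
    nlinarith
  -- second application
  set d2 := Nat.sqrt (2 * Bad.card) + 1 with hd2'
  have hd21 : 2 * Bad.card < d2 ^ 2 := by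
    have := Nat.lt_succ_sqrt' (2 * Bad.card)
    simpa [hd2'] using this
  have hd22 : (d2 : ℝ) ≤ 0.033 * s := by
    have e1 : (Nat.sqrt (2 * Bad.card) : ℝ) ^ 2 ≤ (0.032 * s) ^ 2 := by
      have : (Nat.sqrt (2 * Bad.card) : ℝ) ^ 2 ≤ 2 * Bad.card := by
        exact_mod_cast Nat.sqrt_le' (2 * Bad.card)
      nlinarith
    have e2 := abs_le_of_sq_le_sq e1 (by positivity)
    rw [hd2']; push_cast
    linarith [le_abs_self (Nat.sqrt (2 * Bad.card) : ℝ)]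
  have hdp2 : 9 * d2 < p := by
    have : (9 * d2 : ℝ) < p := by linarith
    exact_mod_cast this
  obtain ⟨F1s, hF1s, Bad2, hBad2, hBc2, hrich2, hI2⟩ := lemmaS p Bad F1 Bad (h2.mono hBad) h1 k (c2.mono hBad)
    d2 hdp2 (le_refl _) hd21
  have hBc2' : (Bad2.card : ℝ) ≤ 0.06 * s ^ 2 := by
    have : (Bad2.card : ℝ) ≤ 54 * (d2 : ℝ) ^ 2 := by exact_mod_cast hBc2
    have : (d2 : ℝ) ^ 2 ≤ (0.033 * s) ^ 2 := by gcongr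
    nlinarith
  refine ⟨Bad2, hBad2, Bad, hBad, by nlinarith, by nlinarith, ?_⟩
  -- bound for II F1 Bad
  have i1 : II F1 Bad ≤ 3 * d2 * F1.card + II Bad F1s := by
    rw [II_comm]
    have : II Bad F1 ≤ II Bad (F1 \ F1s) + II Bad F1s := by
      refine (II_mono (le_refl _) ?_).trans (II_union _ _ _)
      intro g hg
      rw [mem_union, mem_sdiff]; tauto
    refine this.trans (Nat.add_le_add_right ?_ _)
    unfold II
    refine (sum_le_card_nsmul _ _ (3 * d2) ?_).trans ?_
    · intro g hg
      rw [mem_sdiff] at hg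
      by_contra h
      exact hg.2 (hrich2 g hg.1 (not_le.1 h))
    · rw [smul_eq_mul, mul_comm]
      exact Nat.mul_le_mul_left _ (card_le_card sdiff_subset)
  have i2 : (II F1 Bad : ℝ) ≤ 0.3 * s ^ 3 + k * s ^ 2 + II Bad Bad2 := by
    have j1 : (II F1 Bad : ℝ) ≤ 3 * d2 * F1.card + II Bad F1s := by exact_mod_cast i1
    have j2 : (II Bad F1s : ℝ) ≤ 3 * d2 * Bad.card + (3 * d2 + k) * F1.card + II Bad Bad2 := by exact_mod_cast hI2
    have m1 : (d2 : ℝ) * F1.card ≤ (0.033 * s) * s ^ 2 := by gcongr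
    have m2 : (d2 : ℝ) * Bad.card ≤ (0.033 * s) * (0.000486 * s ^ 2) := by gcongr
    have m3 : (k : ℝ) * F1.card ≤ k * s ^ 2 := by gcongr
    have : 0 ≤ s ^ 3 := by positivity
    linarith
  have i3 : (II F1 F2s : ℝ) ≤ 0.4 * s ^ 3 + 2 * k * s ^ 2 + II Bad Bad2 := by
    have j1 : (II F1 F2s : ℝ) ≤ 3 * d * F1.card + (3 * d + k) * F2.card + II F1 Bad := by exact_mod_cast hI
    have m1 : (d : ℝ) * F1.card ≤ (0.003 * s) * s ^ 2 := by gcongr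
    have m2 : (d : ℝ) * F2.card ≤ (0.003 * s) * s ^ 2 := by gcongr
    have m3 : (k : ℝ) * F2.card ≤ k * s ^ 2 := by gcongr
    have : 0 ≤ s ^ 3 := by positivity
    linarith
  have i4 : (II F1 F2 : ℝ) ≤ 20000 * s ^ 3 + 2 * II F1 F2s :=
    step_split s q (by linarith) hq F1 F2 F2s T J d hd2 (by linarith) hrich n2 hJ hTs
  have : 0 ≤ s ^ 3 := by positivity
  linarith

theorem incidence_bound (p : ℕ) [CharP K p] (k : ℕ) (m : ℕ) : ∀ (s : ℝ), 0 ≤ s → s ≤ p → s ≤ 1000 * 2 ^ m →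
    ∀ (F1 F2 : Finset (K × K × K)), Inj3 F1 → Inj3 F2 → Col F1 k → Col F2 k →
    (F1.card : ℝ) ≤ s ^ 2 → (F2.card : ℝ) ≤ s ^ 2 →
     (II F1 F2 : ℝ) ≤ 100000 * (s ^ 3 + k * s ^ 2) := by
  have small : ∀ (s : ℝ), 0 ≤ s → s ≤ 1000 → ∀ (F1 F2 : Finset (K × K × K)),
    (F1.card : ℝ) ≤ s ^ 2 → (F2.card : ℝ) ≤ s ^ 2 →
     (II F1 F2 : ℝ) ≤ 100000 * (s ^ 3 + k * s ^ 2) := by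
    intro s hs0 hs F1 F2 n1 n2
    have h1 : (II F1 F2 : ℝ) ≤ F1.card * F2.card := by exact_mod_cast II_trivial F1 F2
    have h2 : (F1.card * F2.card : ℝ) ≤ s ^ 2 * s ^ 2 := by gcongr
    have h3 : s ^ 2 * s ^ 2 ≤ 1000 * s ^ 3 := by
      have : 0 ≤ s ^ 3 := by positivity
      nlinarith
    have h4 : 0 ≤ (k : ℝ) * s ^ 2 := by positivity
    have h5 : 0 ≤ s ^ 3 := by positivity
    linarith
  induction m with
  | zero =>
    intro s hs0 hsp hs F1 F2 _ _ _ _ n1 n2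
    exact small s hs0 (by simpa using hs) F1 F2 n1 n2
  | succ m ih =>
    intro s hs0 hsp hs F1 F2 h1 h2 c1 c2 n1 n2
    by_cases hs1 : s ≤ 1000
    · exact small s hs0 hs1 F1 F2 n1 n2
    obtain ⟨G1, hG1, G2, hG2, m1, m2, h⟩ := incidence_step p k s (not_le.1 hs1).le hsp F1 F2 h1 h2 c1 c2 n1 n2
    have := ih (s / 2) (by linarith) (by linarith) (by rw [pow_succ] at hs; linarith) G2 G1
      (h2.mono hG2) (h1.mono hG1) (c2.mono hG2) (c1.mono hG1) m2 m1
    have h4 : 0 ≤ (k : ℝ) * s ^ 2 := by positivity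
    have h5 : 0 ≤ s ^ 3 := by positivity
    nlinarith

theorem incidence_main (p : ℕ) [CharP K p] (k : ℕ) (s : ℝ) (hs : 0 ≤ s) (hsp : s ≤ p)
    (F1 F2 : Finset (K × K × K)) (h1 : Inj3 F1) (h2 : Inj3 F2) (c1 : Col F1 k) (c2 : Col F2 k)
    (n1 : (F1.card : ℝ) ≤ s ^ 2) (n2 : (F2.card : ℝ) ≤ s ^ 2) :
     (II F1 F2 : ℝ) ≤ 100000 * (s ^ 3 + k * s ^ 2) := by
  obtain ⟨m, hm⟩ := pow_unbounded_of_one_lt s (one_lt_two (α := ℝ))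
  exact incidence_bound p k m s hs hsp (by
    have : (0:ℝ) < 2 ^ m := by positivity
    linarith) F1 F2 h1 h2 c1 c2 n1 n2

end CT

namespace CT
open scoped Classical

/-- all triples collinear -/
def AllCol {K : Type*} [Field K] (T : Finset (K × K × K)) : Prop :=
  ∀ f ∈ T, ∀ g ∈ T, ∀ h ∈ T,
    (g.1 - f.1) * (h.2.1 - f.2.1) = (h.1 - f.1) * (g.2.1 - f.2.1) ∧
    (g.1 - f.1) * (h.2.2 - f.2.2) = (h.1 - f.1) * (g.2.2 - f.2.2) ∧
    (g.2.1 - f.2.1) * (h.2.2 - f.2.2) = (h.2.1 - f.2.1) * (g.2.2 - f.2.2)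

variable {K : Type*} [Field K]

/-- projective transformation -/
noncomputable def phi (θ : K) (f : K × K × K) : K × K × K :=
  (f.1 / (1 + θ ^ 2 * f.1), f.2.1 / (1 + θ ^ 2 * f.1),
    (f.2.2 + θ * f.1 + θ ^ 2 * f.2.1) / (1 + θ ^ 2 * f.1))

lemma phi_inc (θ : K) (f g : K × K × K) (hf : 1 + θ ^ 2 * f.1 ≠ 0) (hg : 1 + θ ^ 2 * g.1 ≠ 0) :
    Inc (phi θ f) (phi θ g) ↔ Inc f g := by
  obtain ⟨u, v, z⟩ := f
  obtain ⟨s, t, y⟩ := g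
  simp only [Inc, phi] at *
  have h1 : u / (1 + θ ^ 2 * u) * ((y + θ * s + θ ^ 2 * t) / (1 + θ ^ 2 * s)) + v / (1 + θ ^ 2 * u)
     - (s / (1 + θ ^ 2 * s) * ((z + θ * u + θ ^ 2 * v) / (1 + θ ^ 2 * u)) + t / (1 + θ ^ 2 * s))
     = (u * y + v - (s * z + t)) / ((1 + θ ^ 2 * u) * (1 + θ ^ 2 * s)) := by
    generalize hD : 1 + θ ^ 2 * u = D at *
    generalize hE : 1 + θ ^ 2 * s = E at *
    field_simp
    linear_combination -v * hE + t * hD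
  rw [← sub_eq_zero, h1, div_eq_zero_iff, or_iff_left (mul_ne_zero hf hg), sub_eq_zero]

lemma exists_theta [Infinite K] (F : Finset (K × K × K)) :
    ∃ θ : K, (∀ f ∈ F, 1 + θ ^ 2 * f.1 ≠ 0) ∧
      Set.InjOn (fun f => (phi θ f).2.2) (F : Set (K × K × K)) := by
  open Polynomial in
  let P1 : K × K × K → K[X] := fun f => C 1 + C f.1 * X ^ 2
  let P2 : K × K × K → K × K × K → K[X] := fun f g => C (f.2.2 - g.2.2) + C (f.1 - g.1) * X +
    C (f.2.1 - g.2.1 + f.2.2 * g.1 - g.2.2 * f.1) * X ^ 2 + C (f.2.1 * g.1 - g.2.1 * f.1) * X ^ 4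
  have hP1 : ∀ f, P1 f ≠ 0 := by
    intro f h
    have := congrArg (Polynomial.eval 0) h
    simp [P1] at this
  have hP2 : ∀ f g, f ≠ g → P2 f g ≠ 0 := by
    intro f g hfg h
    apply hfg
    have c0 := congrArg (fun q => Polynomial.coeff q 0) h
    have c1 := congrArg (fun q => Polynomial.coeff q 1) h
    have c2 := congrArg (fun q => Polynomial.coeff q 2) h
    simp only [P2] at c0 c1 c2
    generalize hw : f.2.1 - g.2.1 + f.2.2 * g.1 - g.2.2 * f.1 = w at c0 c1 c2
    generalize f.2.1 * g.1 - g.2.1 * f.1 = w' at c0 c1 c2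
    simp [Polynomial.coeff_X, Polynomial.coeff_C] at c0 c1 c2
    rw [c2] at hw
    have e1 : f.2.2 = g.2.2 := sub_eq_zero.1 c0
    have e2 : f.1 = g.1 := sub_eq_zero.1 c1
    have e3 : f.2.1 = g.2.1 := by
      rw [e1, e2] at hw; linear_combination hw
    ext <;> assumption
  let P : K[X] := (∏ f ∈ F, P1 f) * ∏ fg ∈ F.offDiag, P2 fg.1 fg.2
  have hP : P ≠ 0 := by
    apply mul_ne_zero
    · exact prod_ne_zero_iff.2 (fun f _ => hP1 f)
    · exact prod_ne_zero_iff.2 (fun f hf => hP2 _ _ (mem_offDiag.1 hf).2.2)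
  obtain ⟨θ, hθ⟩ : ∃ θ, P.eval θ ≠ 0 := by
    by_contra! h
    exact hP (Polynomial.funext (by simpa using h))
  simp only [P, Polynomial.eval_mul, Polynomial.eval_prod] at hθ
  have h1 := prod_ne_zero_iff.1 (left_ne_zero_of_mul hθ)
  have h2 := prod_ne_zero_iff.1 (right_ne_zero_of_mul hθ)
  have h1' : ∀ f ∈ F, 1 + θ ^ 2 * f.1 ≠ 0 := by
    intro f hf
    have := h1 f hf
    simp [P1] at this
    rwa [mul_comm]
  refine ⟨θ, h1', ?_⟩
  intro f hf g hg h
  by_contra hne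
  have h3 := h2 (f, g) (mem_offDiag.2 ⟨hf, hg, hne⟩)
  apply h3
  have hf' := h1' f hf
  have hg' := h1' g hg
  simp only [phi] at h
  rw [div_eq_div_iff hf' hg'] at h
  simp only [P2, Polynomial.eval_add, Polynomial.eval_mul, Polynomial.eval_C, Polynomial.eval_X, Polynomial.eval_pow]
  linear_combination h

lemma line_allcol (θ : K) (T : Finset (K × K × K)) (hT : ∀ f ∈ T, 1 + θ ^ 2 * f.1 ≠ 0) (α β γ δ : K)
    (h : ∀ f ∈ T, (phi θ f).1 = α * (phi θ f).2.2 + β ∧ (phi θ f).2.1 = γ * (phi θ f).2.2 + δ) :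
    AllCol T := by
  have h1 : ∀ f ∈ T, f.1 = α * (f.2.2 + θ * f.1 + θ ^ 2 * f.2.1) + β * (1 + θ ^ 2 * f.1) := by
    intro f hf
    have h0 := hT f hf
    have := (h f hf).1
    simp only [phi] at this
    generalize 1 + θ ^ 2 * f.1 = D at *
    field_simp at this
    linear_combination this
  have h2 : ∀ f ∈ T, f.2.1 = γ * (f.2.2 + θ * f.1 + θ ^ 2 * f.2.1) + δ * (1 + θ ^ 2 * f.1) := by
    intro f hf
    have h0 := hT f hf
    have := (h f hf).2
    simp only [phi] at this
    generalize 1 + θ ^ 2 * f.1 = D at *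
    field_simp at this
    linear_combination this
  suffices hs : ∃ e0 e1 e2 : K, ∀ f ∈ T, ∀ g ∈ T, ∃ x : K, g.1 - f.1 = x * e0 ∧ g.2.1 - f.2.1 = x * e1 ∧ g.2.2 - f.2.2 = x * e2 by
    obtain ⟨e0, e1, e2, he⟩ := hs
    intro f hf g hg k hk
    obtain ⟨x, x0, x1, x2⟩ := he f hf g hg
    obtain ⟨y, y0, y1, y2⟩ := he f hf k hk
    rw [x0, x1, x2, y0, y1, y2]
    refine ⟨by ring, by ring, by ring⟩
  rcases T.eq_empty_or_nonempty with rfl | ⟨f0, hf0⟩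
  · exact ⟨0, 0, 0, by simp⟩
  by_cases hb : 1 - β * θ ^ 2 = 0
  · have hα : α ≠ 0 := by
      intro h0
      have := h1 f0 hf0
      rw [h0] at this
      have hbz : β = 0 := by linear_combination -this + f0.1 * hb
      rw [hbz] at hb
      simp at hb
    refine ⟨1, δ * θ ^ 2, -θ - θ ^ 2 * (δ * θ ^ 2), ?_⟩
    intro f hf g hg
    have w : (g.2.2 - f.2.2) + θ * (g.1 - f.1) + θ ^ 2 * (g.2.1 - f.2.1) = 0 := by
      apply mul_left_cancel₀ hα
      linear_combination h1 f hf - h1 g hg + (g.1 - f.1) * hb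
    have v : g.2.1 - f.2.1 = (g.1 - f.1) * (δ * θ ^ 2) := by
      linear_combination h2 g hg - h2 f hf + γ * w
    refine ⟨g.1 - f.1, by ring, v, ?_⟩
    linear_combination w - θ ^ 2 * v
  · refine ⟨α / (1 - β * θ ^ 2), γ + δ * θ ^ 2 * (α / (1 - β * θ ^ 2)),
      1 - θ * (α / (1 - β * θ ^ 2)) - θ ^ 2 * (γ + δ * θ ^ 2 * (α / (1 - β * θ ^ 2))), ?_⟩
    intro f hf g hg
    have u : g.1 - f.1 = ((g.2.2 - f.2.2) + θ * (g.1 - f.1) + θ ^ 2 * (g.2.1 - f.2.1)) * (α / (1 - β * θ ^ 2)) := by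
      rw [← mul_div_assoc, eq_div_iff hb]
      linear_combination h1 g hg - h1 f hf
    have v : g.2.1 - f.2.1 = ((g.2.2 - f.2.2) + θ * (g.1 - f.1) + θ ^ 2 * (g.2.1 - f.2.1)) * (γ + δ * θ ^ 2 * (α / (1 - β * θ ^ 2))) := by
      linear_combination h2 g hg - h2 f hf + δ * θ ^ 2 * u
    refine ⟨_, u, v, ?_⟩
    linear_combination - θ * u - θ ^ 2 * v

theorem incidence_generic [Infinite K] (p : ℕ) [CharP K p] (k : ℕ) (s : ℝ) (hs : 0 ≤ s) (hsp : s ≤ p)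
    (F : Finset (K × K × K)) (hk : ∀ T ⊆ F, AllCol T → T.card ≤ k)
    (n1 : (F.card : ℝ) ≤ s ^ 2) : (II F F : ℝ) ≤ 100000 * (s ^ 3 + k * s ^ 2) := by
  obtain ⟨θ, hθ, hinj⟩ := exists_theta F
  have hφ : Set.InjOn (phi θ) (F : Set (K × K × K)) := by
    intro f hf g hg h
    exact hinj hf hg (by simp only [h])
  have hI : II F F = II (F.image (phi θ)) (F.image (phi θ)) := by
    unfold II
    rw [sum_image hφ]
    apply sum_congr rfl
    intro g hg
    rw [filter_image, card_image_of_injOn]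
    · congr 1
      apply filter_congr
      intro f hf
      rw [phi_inc θ f g (hθ f hf) (hθ g hg)]
    · intro x hx y hy
      simp only [coe_filter, Set.mem_ofPred_eq] at hx hy
      exact hφ hx.1 hy.1
  have h3 : Inj3 (F.image (phi θ)) := by
    intro x hx y hy h
    rw [mem_coe, mem_image] at hx hy
    obtain ⟨f, hf, rfl⟩ := hx
    obtain ⟨g, hg, rfl⟩ := hy
    rw [hinj hf hg h]
  have hc : Col (F.image (phi θ)) k := by
    intro α β γ δ
    rw [filter_image]
    refine card_image_le.trans (hk _ (filter_subset _ _) ?_)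
    apply line_allcol θ _ _ α β γ δ
    · intro f hf
      exact (mem_filter.1 hf).2
    · intro f hf
      exact hθ f (mem_filter.1 hf).1
  have hcard : ((F.image (phi θ)).card : ℝ) ≤ s ^ 2 :=
    le_trans (by exact_mod_cast card_image_le) n1
  rw [hI]
  exact incidence_main p k s hs hsp _ _ h3 h3 hc hc hcard hcard

theorem incidence_zmod (p : ℕ) [Fact p.Prime] (k : ℕ) (s : ℝ) (hs : 0 ≤ s) (hsp : s ≤ p)
    (F : Finset (ZMod p × ZMod p × ZMod p)) (hk : ∀ T ⊆ F, AllCol T → T.card ≤ k)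
    (n1 : (F.card : ℝ) ≤ s ^ 2) : (II F F : ℝ) ≤ 100000 * (s ^ 3 + k * s ^ 2) := by
  let K := AlgebraicClosure (ZMod p)
  have : CharP K p := charP_of_injective_algebraMap (algebraMap (ZMod p) K).injective p
  have : Infinite K := IsAlgClosed.instInfinite
  let j : ZMod p →+* K := algebraMap (ZMod p) K
  have hj : Function.Injective j := (algebraMap (ZMod p) K).injective
  let ι : ZMod p × ZMod p × ZMod p → K × K × K := fun f => (j f.1, j f.2.1, j f.2.2)
  have hι : Function.Injective ι := by
    intro f g h
    simp only [ι, Prod.mk.injEq] at h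
    ext1
    · exact hj h.1
    · ext1
      · exact hj h.2.1
      · exact hj h.2.2
  have hinc : ∀ f g, Inc (ι f) (ι g) ↔ Inc f g := by
    intro f g
    simp only [Inc, ι, ← map_mul, ← map_add]
    exact hj.eq_iff
  have hI : II F F = II (F.image ι) (F.image ι) := by
    unfold II
    rw [sum_image hι.injOn]
    apply sum_congr rfl
    intro g hg
    rw [filter_image, card_image_of_injective _ hι]
    simp only [hinc]
  rw [hI]
  apply incidence_generic p k s hs hsp
  · intro T hT hcol
    have hT' : T = (F.filter (fun f => ι f ∈ T)).image ι := by
      ext x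
      rw [mem_image]
      constructor
      · intro hx
        obtain ⟨f, hf, rfl⟩ := mem_image.1 (hT hx)
        exact ⟨f, mem_filter.2 ⟨hf, hx⟩, rfl⟩
      · rintro ⟨f, hf, rfl⟩
        exact (mem_filter.1 hf).2
    rw [hT']
    refine card_image_le.trans (hk _ (filter_subset _ _) ?_)
    intro f hf g hg h hh
    have := hcol _ (mem_filter.1 hf).2 _ (mem_filter.1 hg).2 _ (mem_filter.1 hh).2
    simp only [ι, ← map_mul, ← map_sub] at this
    exact ⟨hj this.1, hj this.2.1, hj this.2.2⟩
  · exact le_trans (by exact_mod_cast card_image_le) n1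

end CT

namespace CT
open scoped Classical

/-- number of points of A x B on the line l -/
noncomputable def cnt {p : ℕ} (A B : Finset (ZMod p)) (l : ZMod p × ZMod p) : ℕ :=
  (A.filter (fun a => l.1 * a + l.2 ∈ B)).card

variable {p : ℕ} [Fact p.Prime]

lemma allcol_inj (T : Finset (ZMod p × ZMod p × ZMod p)) (hT : AllCol T)
    (f0 g0) (hf0 : f0 ∈ T) (hg0 : g0 ∈ T) (hne : f0.2 ≠ g0.2) :
    Set.InjOn (fun f => f.2) (T : Set (ZMod p × ZMod p × ZMod p)) := by
  intro f hf g hg h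
  simp only at h
  by_contra hfg
  have h1 : g.1 - f.1 ≠ 0 := by
    intro h1
    exact hfg (Prod.ext (sub_eq_zero.1 h1).symm h)
  have key : ∀ k ∈ T, k.2 = f.2 := by
    intro k hk
    have h2 := hT f hf g hg k hk
    rw [← h] at h2
    have e1 : k.2.1 - f.2.1 = 0 := by
      apply mul_left_cancel₀ h1
      linear_combination h2.1
    have e2 : k.2.2 - f.2.2 = 0 := by
      apply mul_left_cancel₀ h1
      linear_combination h2.2.1
    exact Prod.ext (sub_eq_zero.1 e1) (sub_eq_zero.1 e2)
  exact hne ((key _ hf0).trans (key _ hg0).symm)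

lemma allcol_conc (T : Finset (ZMod p × ZMod p × ZMod p)) (hT : AllCol T) :
    ∃ κ : ZMod p, ∀ f ∈ T, ∀ g ∈ T, ∀ x, x ≠ κ → f.2.2 * x - f.2.1 = g.2.2 * x - g.2.1 → f.2 = g.2 := by
  by_cases hall : ∀ f ∈ T, ∀ g ∈ T, f.2.2 = g.2.2
  · refine ⟨0, ?_⟩
    intro f hf g hg x _ h
    have h1 := hall f hf g hg
    refine Prod.ext ?_ h1
    rw [h1] at h
    linear_combination -h
  · push Not at hall
    obtain ⟨f0, hf0, g0, hg0, hne⟩ := hall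
    have hne' : g0.2.2 - f0.2.2 ≠ 0 := sub_ne_zero.2 (Ne.symm hne)
    refine ⟨(g0.2.1 - f0.2.1) / (g0.2.2 - f0.2.2), ?_⟩
    have key : ∀ f ∈ T, f.2.1 - f0.2.1 = (g0.2.1 - f0.2.1) / (g0.2.2 - f0.2.2) * (f.2.2 - f0.2.2) := by
      intro f hf
      have := (hT f0 hf0 g0 hg0 f hf).2.2
      rw [div_mul_eq_mul_div, eq_div_iff hne', this]
    generalize (g0.2.1 - f0.2.1) / (g0.2.2 - f0.2.2) = κ at *
    intro f hf g hg x hx h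
    have h1 := key f hf
    have h2 := key g hg
    have h3 : f.2.2 - g.2.2 = 0 := by
      apply mul_left_cancel₀ (sub_ne_zero.2 hx)
      linear_combination h + h1 - h2
    refine Prod.ext ?_ (sub_eq_zero.1 h3)
    linear_combination h1 - h2 + κ * h3

lemma allcol_bound (A B : Finset (ZMod p)) (hAB : A.card ≤ B.card) (k : ℕ) 
    (L : Finset (ZMod p × ZMod p)) (hL : ∀ l ∈ L, k ≤ cnt A B l)
    (T : Finset (ZMod p × ZMod p × ZMod p)) (hT : AllCol T)
    (hTL : ∀ f ∈ T, f.1 ∈ A ∧ (f.2.2, -f.2.1) ∈ L) :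
    T.card * (k - 1) ≤ A.card * B.card := by
  by_cases hall : ∀ f ∈ T, ∀ g ∈ T, f.2 = g.2
  · rcases T.eq_empty_or_nonempty with rfl | ⟨f0, hf0⟩
    · simp
    apply Nat.mul_le_mul
    · apply card_le_card_of_injOn (fun f => f.1)
      · intro f hf
        exact (hTL f hf).1
      · intro f hf g hg h
        exact Prod.ext h (hall f hf g hg)
    · have h1 := hL _ (hTL f0 hf0).2
      have h2 : cnt A B (f0.2.2, -f0.2.1) ≤ A.card := card_filter_le _ _
      omega
  · push Not at hall
    obtain ⟨f0, hf0, g0, hg0, hne⟩ := hall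
    have hinj := allcol_inj T hT f0 g0 hf0 hg0 hne
    obtain ⟨κ, hκ⟩ := allcol_conc T hT
    rw [← card_product]
    have h1 : ((T ×ˢ A).filter (fun x => x.2 ≠ κ ∧ x.1.2.2 * x.2 - x.1.2.1 ∈ B)).card ≤ (A ×ˢ B).card := by
      apply card_le_card_of_injOn (fun x => (x.2, x.1.2.2 * x.2 - x.1.2.1))
      · intro x hx
        have hx' := mem_filter.1 (mem_coe.1 hx)
        exact mem_coe.2 (mem_product.2 ⟨(mem_product.1 hx'.1).2, hx'.2.2⟩)
      · intro x hx y hy h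
        have hx' := mem_filter.1 (mem_coe.1 hx)
        have hy' := mem_filter.1 (mem_coe.1 hy)
        simp only [Prod.mk.injEq] at h
        refine Prod.ext ?_ h.1
        have hx1 := (mem_product.1 hx'.1).1
        have hy1 := (mem_product.1 hy'.1).1
        apply hinj hx1 hy1
        apply hκ _ hx1 _ hy1 x.2 hx'.2.1
        rw [h.2, h.1]
    refine le_trans ?_ h1
    rw [card_filter, sum_product, ← smul_eq_mul]
    apply card_nsmul_le_sum
    intro f hf
    rw [← card_filter]
    have h2 := hL _ (hTL f hf).2
    unfold cnt at h2
    have h3 : (A.filter (fun a => f.2.2 * a + -f.2.1 ∈ B)).erase κ ⊆ A.filter (fun a => a ≠ κ ∧ f.2.2 * a - f.2.1 ∈ B) := by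
      intro a ha
      have := mem_erase.1 ha
      have h4 := mem_filter.1 this.2
      exact mem_filter.2 ⟨h4.1, this.1, by rw [sub_eq_add_neg]; exact h4.2⟩
    have h4 := card_le_card h3
    have h5 := pred_card_le_card_erase (s := A.filter (fun a => f.2.2 * a + -f.2.1 ∈ B)) (a := κ)
    simp only at h2
    refine le_trans ?_ h4
    omega

lemma rich_cs (A B : Finset (ZMod p)) (k : ℕ) 
    (L : Finset (ZMod p × ZMod p)) (hL : ∀ l ∈ L, k ≤ cnt A B l) :
    (k * L.card) ^ 2 ≤ B.card * II ((A ×ˢ L).image (fun x => (x.1, -x.2.2, x.2.1)))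
      ((A ×ˢ L).image (fun x => (x.1, -x.2.2, x.2.1))) := by
  let r : ZMod p → ℕ := fun y => ((A ×ˢ L).filter (fun x => x.2.1 * x.1 + x.2.2 = y)).card
  have h1 : k * L.card ≤ ∑ y ∈ B, r y := by
    have : ∑ y ∈ B, r y = ∑ l ∈ L, cnt A B l := by
      simp only [r, cnt, card_filter, sum_product]
      rw [sum_comm]
      rw [sum_comm (s := L)]
      apply sum_congr rfl
      intro a ha
      rw [sum_comm]
      apply sum_congr rfl
      intro l hl
      rw [sum_ite_eq]
    rw [this, mul_comm, ← smul_eq_mul]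
    exact card_nsmul_le_sum _ _ _ hL
  have h2 : (∑ y ∈ B, r y) ^ 2 ≤ B.card * ∑ y ∈ B, r y ^ 2 := sq_sum_le_card_mul_sum_sq
  refine (Nat.pow_le_pow_left h1 2).trans (h2.trans (Nat.mul_le_mul_left _ ?_))
  set F := (A ×ˢ L).image (fun x => (x.1, -x.2.2, x.2.1)) with hF
  have h3 : II F F = ((F ×ˢ F).filter (fun x => Inc x.2 x.1)).card := by
    rw [card_filter, sum_product]
    unfold II
    simp only [card_filter]
  have h4 : ∑ y ∈ B, r y ^ 2 = (B.sigma (fun y => ((A ×ˢ L).filter (fun x => x.2.1 * x.1 + x.2.2 = y)) ×ˢ ((A ×ˢ L).filter (fun x => x.2.1 * x.1 + x.2.2 = y)))).card := by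
    rw [card_sigma]
    apply sum_congr rfl
    intro y _
    rw [card_product, sq]
  rw [h3, h4]
  apply card_le_card_of_injOn (fun x => ((x.2.1.1, -x.2.2.2.2, x.2.2.2.1), (x.2.2.1, -x.2.1.2.2, x.2.1.2.1)))
  · intro x hx
    simp only [mem_coe, mem_sigma, mem_product, mem_filter] at hx
    obtain ⟨hy, ⟨⟨h1, h2⟩, h3⟩, ⟨h5, h6⟩, h7⟩ := hx
    simp only [mem_coe, mem_filter, mem_product]
    refine ⟨⟨?_, ?_⟩, ?_⟩
    · rw [hF, mem_image]
      exact ⟨(x.2.1.1, x.2.2.2), mem_product.2 ⟨h1, h6⟩, rfl⟩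
    · rw [hF, mem_image]
      exact ⟨(x.2.2.1, x.2.1.2), mem_product.2 ⟨h5, h2⟩, rfl⟩
    · simp only [Inc]
      linear_combination h7 - h3
  · rintro ⟨y, ⟨a, m, c⟩, ⟨a', m', c'⟩⟩ hx ⟨y1, ⟨a1, m1, c1⟩, ⟨a1', m1', c1'⟩⟩ hx' h
    simp only [mem_coe, mem_sigma, mem_product, mem_filter] at hx hx'
    simp only [Prod.mk.injEq, neg_inj] at h
    obtain ⟨⟨rfl, rfl, rfl⟩, rfl, rfl, rfl⟩ := h
    obtain rfl : y = y1 := by rw [← hx.2.1.2, ← hx'.2.1.2]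
    rfl

lemma real_a (k L A B : ℝ) (hk : 0 < k) (hL : 0 < L) (hA : 0 < A) (hB : 0 < B) (s : ℝ) (hs : 0 ≤ s) (hs2 : s ^ 2 = A * L)
   (h : (k * L) ^ 2 ≤ 200000 * B * s ^ 3) : k ^ 4 * L ≤ 40000000000 * (A ^ 3 * B ^ 2) := by
  have h1 : ((k * L) ^ 2) ^ 2 ≤ (200000 * B * s ^ 3) ^ 2 := by gcongr
  have h2 : (200000 * B * s ^ 3) ^ 2 = 40000000000 * (A ^ 3 * B ^ 2) * L ^ 3 := by
    have : (200000 * B * s ^ 3) ^ 2 = 40000000000 * B ^ 2 * (s ^ 2) ^ 3 := by ring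
    rw [this, hs2]; ring
  rw [h2] at h1
  have h3 : ((k * L) ^ 2) ^ 2 = k ^ 4 * L * L ^ 3 := by ring
  rw [h3] at h1
  exact le_of_mul_le_mul_right h1 (by positivity)

lemma real_b (k L A B k2 : ℝ) (hk : 2 ≤ k) (hL : 0 < L) (hA : 0 < A) (hB : 0 < B) (hkA : k ≤ A) (hk2 : k2 * (k - 1) ≤ A * B)
   (hk0 : 0 ≤ k2)
   (h : (k * L) ^ 2 ≤ 200000 * B * (k2 * (A * L))) : k ^ 4 * L ≤ 40000000000 * (A ^ 3 * B ^ 2) := by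
  have e1 : k ^ 2 * L ≤ 200000 * A * B * k2 := by
    apply le_of_mul_le_mul_right _ hL
    linarith
  have e2 : k2 * k ≤ 2 * (A * B) := by
    have : k2 * 2 ≤ k2 * k := by gcongr
    linarith
  have e3 : k ^ 4 * L = (k ^ 2 * L) * k * k := by ring
  have hk' : 0 ≤ k := by linarith
  calc k ^ 4 * L = (k ^ 2 * L) * k * k := e3
    _ ≤ (200000 * A * B * k2) * k * k := by gcongr
    _ = (200000 * A * B) * (k2 * k) * k := by ring
    _ ≤ (200000 * A * B) * (2 * (A * B)) * A := by gcongr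
    _ = 400000 * (A ^ 3 * B ^ 2) := by ring
    _ ≤ _ := by gcongr; norm_num

lemma rich (A B : Finset (ZMod p)) (hAB : A.card ≤ B.card) (k : ℕ) (hk : 2 ≤ k)
    (L : Finset (ZMod p × ZMod p)) (hL : ∀ l ∈ L, k ≤ cnt A B l) (hLp : A.card * L.card ≤ p ^ 2) :
    (k : ℝ) ^ 4 * L.card ≤ 40000000000 * ((A.card : ℝ) ^ 3 * (B.card : ℝ) ^ 2) := by
  rcases L.eq_empty_or_nonempty with rfl | hne
  · simp; positivity
  obtain ⟨l0, hl0⟩ := hne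
  have hkA : k ≤ A.card := (hL _ hl0).trans (card_filter_le _ _)
  have hLpos : 0 < L.card := card_pos.2 ⟨l0, hl0⟩
  have hcs := rich_cs A B k L hL
  set F := (A ×ˢ L).image (fun x => (x.1, -x.2.2, x.2.1)) with hF
  have hFc : F.card ≤ A.card * L.card := by
    rw [← card_product]; exact card_image_le
  have hFL : ∀ f ∈ F, f.1 ∈ A ∧ (f.2.2, -f.2.1) ∈ L := by
    intro f hf
    obtain ⟨x, hx, rfl⟩ := mem_image.1 hf
    have := mem_product.1 hx
    refine ⟨this.1, ?_⟩
    simpa using this.2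
  set s : ℝ := Real.sqrt (A.card * L.card) with hs
  have hs0 : 0 ≤ s := Real.sqrt_nonneg _
  have hs2 : s ^ 2 = A.card * L.card := Real.sq_sqrt (by positivity)
  have hsp : s ≤ p := by
    rw [hs]
    apply Real.sqrt_le_iff.2
    refine ⟨by positivity, by exact_mod_cast hLp⟩
  have hinc := incidence_zmod p (A.card * B.card / (k - 1)) s hs0 hsp F (by
    intro T hT hcol
    rw [Nat.le_div_iff_mul_le (by omega)]
    exact allcol_bound A B hAB k L hL T hcol (fun f hf => hFL f (hT hf))) (by
    rw [hs2]; exact_mod_cast hFc)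
  have hk2 : ((A.card * B.card / (k - 1) : ℕ) : ℝ) * ((k : ℝ) - 1) ≤ A.card * B.card := by
    have := Nat.div_mul_le_self (A.card * B.card) (k - 1)
    have h2 : ((k - 1 : ℕ) : ℝ) = (k : ℝ) - 1 := by
      rw [Nat.cast_sub (by omega)]; simp
    rw [← h2]
    exact_mod_cast this
  generalize A.card * B.card / (k - 1) = k2 at hinc hk2
  have hcs' : ((k : ℝ) * L.card) ^ 2 ≤ B.card * (II F F : ℝ) := by exact_mod_cast hcs
  have hBpos : 0 < B.card := by omega
  have hmain : ((k : ℝ) * L.card) ^ 2 ≤ B.card * (100000 * (s ^ 3 + k2 * s ^ 2)) :=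
    hcs'.trans (by gcongr)
  have hA' : (0 : ℝ) < A.card := by exact_mod_cast (by omega : 0 < A.card)
  have hB' : (0 : ℝ) < B.card := by exact_mod_cast hBpos
  have hL' : (0 : ℝ) < L.card := by exact_mod_cast hLpos
  have hk' : (2 : ℝ) ≤ k := by exact_mod_cast hk
  have hkA' : (k : ℝ) ≤ A.card := by exact_mod_cast hkA
  rcases le_total ((k2 : ℝ) * s ^ 2) (s ^ 3) with hc | hc
  · apply real_a k L.card A.card B.card (by linarith) hL' hA' hB' s hs0 hs2
    refine hmain.trans ?_
    have := mul_le_mul_of_nonneg_left hc hB'.le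
    linarith
  · apply real_b k L.card A.card B.card k2 hk' hL' hA' hB' hkA' hk2 (by positivity)
    rw [← hs2]
    refine hmain.trans ?_
    have := mul_le_mul_of_nonneg_left hc hB'.le
    linarith

/-- set of k-rich lines -/
noncomputable def LL (A B : Finset (ZMod p)) (k : ℕ) : Finset (ZMod p × ZMod p) :=
  univ.filter (fun l => k ≤ cnt A B l)

lemma rich_full (A B : Finset (ZMod p)) (hAB : A.card ≤ B.card) (k : ℕ) (hk : 2 ≤ k)
    (hbig : 80000000000 * ((A.card : ℝ) ^ 4 * (B.card : ℝ) ^ 2) < (k : ℝ) ^ 4 * (p : ℝ) ^ 2) :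
    (k : ℝ) ^ 4 * (LL A B k).card ≤ 40000000000 * ((A.card : ℝ) ^ 3 * (B.card : ℝ) ^ 2) := by
  have hL : ∀ l ∈ LL A B k, k ≤ cnt A B l := fun l hl => (mem_filter.1 hl).2
  by_cases hLp : A.card * (LL A B k).card ≤ p ^ 2
  · exact rich A B hAB k hk _ hL hLp
  exfalso
  push Not at hLp
  have hApos : 0 < A.card := by
    rcases Nat.eq_zero_or_pos A.card with h | h
    · rw [h] at hLp; simp at hLp
    · exact h
  have hA_le : A.card ≤ p := by
    have := card_le_univ A
    rwa [ZMod.card] at this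
  have hm : p ^ 2 / A.card ≤ (LL A B k).card := by
    apply Nat.div_le_of_le_mul
    exact hLp.le
  obtain ⟨L', hL', hc⟩ := exists_subset_card_eq hm
  have h1 := rich A B hAB k hk L' (fun l hl => hL l (hL' hl)) (by
    rw [hc]; exact Nat.mul_div_le _ _)
  have hp1 : A.card ≤ p ^ 2 := hA_le.trans (by
    have := (Fact.out : p.Prime).pos
    nlinarith)
  have h2 : p ^ 2 ≤ 2 * (A.card * (p ^ 2 / A.card)) := by
    have e1 := Nat.div_add_mod (p ^ 2) A.card
    have e2 := Nat.mod_lt (p ^ 2) hApos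
    have e3 : 1 ≤ p ^ 2 / A.card := by
      rw [Nat.le_div_iff_mul_le hApos]; omega
    have e4 : A.card ≤ A.card * (p ^ 2 / A.card) := Nat.le_mul_of_pos_right _ e3
    omega
  rw [← hc] at h2
  have h2' : (p : ℝ) ^ 2 ≤ 2 * (A.card * L'.card) := by exact_mod_cast h2
  have hA' : (0 : ℝ) < A.card := by exact_mod_cast hApos
  have h3 : (k : ℝ) ^ 4 * (p : ℝ) ^ 2 ≤ (k : ℝ) ^ 4 * (2 * (A.card * L'.card)) := by gcongr
  have h4 := mul_le_mul_of_nonneg_left h1 hA'.le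
  linarith

end CT

namespace CT
open scoped Classical

variable {p : ℕ} [Fact p.Prime]

lemma card_shift (B : Finset (ZMod p)) (x : ZMod p) :
    (univ.filter (fun c => x + c ∈ B)).card = B.card := by
  apply card_nbij' (fun c => x + c) (fun y => y - x)
  · intro c hc
    simpa using hc
  · intro c hc
    simpa using hc
  · intro c _
    simp
  · intro c _
    simp

lemma sum_cnt (A B : Finset (ZMod p)) : ∑ l : ZMod p × ZMod p, cnt A B l = p * (A.card * B.card) := by
  unfold cnt
  simp only [card_filter]
  rw [sum_comm]
  have : ∀ a ∈ A, (∑ l : ZMod p × ZMod p, if l.1 * a + l.2 ∈ B then 1 else 0) = p * B.card := by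
    intro a _
    rw [Fintype.sum_prod_type]
    simp only [← card_filter, card_shift]
    simp
  rw [sum_congr rfl this, sum_const, smul_eq_mul]
  ring

lemma sum_cnt_sq (A B : Finset (ZMod p)) :
    ∑ l : ZMod p × ZMod p, (cnt A B l) ^ 2 ≤ p * (A.card * B.card) + (A.card * B.card) ^ 2 := by
  have h1 : ∀ l, (cnt A B l) ^ 2 = ∑ a ∈ A, ∑ a' ∈ A, if (l.1 * a + l.2 ∈ B ∧ l.1 * a' + l.2 ∈ B) then 1 else 0 := by
    intro l
    rw [sq, cnt, ← card_product, ← filter_product, card_filter, sum_product]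
  simp only [h1]
  rw [sum_comm]
  have h2 : ∀ a ∈ A, (∑ l : ZMod p × ZMod p, ∑ a' ∈ A, if (l.1 * a + l.2 ∈ B ∧ l.1 * a' + l.2 ∈ B) then 1 else 0)
     ≤ p * B.card + A.card * B.card ^ 2 := by
    intro a ha
    rw [sum_comm]
    have h3 : ∀ a' ∈ A, (∑ l : ZMod p × ZMod p, if (l.1 * a + l.2 ∈ B ∧ l.1 * a' + l.2 ∈ B) then 1 else 0)
       ≤ (if a = a' then p * B.card else 0) + B.card ^ 2 := by
      intro a' _
      rw [← card_filter]
      split_ifs with h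
      · subst h
        simp only [and_self]
        have : (univ.filter (fun l : ZMod p × ZMod p => l.1 * a + l.2 ∈ B)).card = p * B.card := by
          rw [card_filter, Fintype.sum_prod_type]
          simp only [← card_filter, card_shift]
          simp
        omega
      · rw [zero_add, sq, ← card_product]
        apply card_le_card_of_injOn (fun l => (l.1 * a + l.2, l.1 * a' + l.2))
        · intro l hl
          simpa using hl
        · intro l _ l' _ hll
          simp only [Prod.mk.injEq] at hll
          have e1 : l.1 = l'.1 := by
            apply mul_right_cancel₀ (sub_ne_zero.2 h)
            linear_combination hll.1 - hll.2
          refine Prod.ext e1 ?_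
          have := hll.1
          rw [e1] at this
          exact add_left_cancel this
    refine (sum_le_sum h3).trans ?_
    rw [sum_add_distrib, sum_ite_eq, if_pos ha, sum_const, smul_eq_mul]
  refine (sum_le_sum h2).trans (le_of_eq ?_)
  rw [sum_const, smul_eq_mul]
  ring

/-- discrepancy -/
noncomputable def del (A B : Finset (ZMod p)) (l : ZMod p × ZMod p) : ℝ :=
  (cnt A B l : ℝ) - (A.card : ℝ) * B.card / p

lemma ppos : (0 : ℝ) < p := by exact_mod_cast (Fact.out : p.Prime).pos

lemma sum_const_real (x : ℝ) : ∑ _l : ZMod p × ZMod p, x = (p : ℝ) ^ 2 * x := by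
  rw [sum_const, card_univ, Fintype.card_prod, ZMod.card, nsmul_eq_mul]
  push_cast
  ring

lemma sum_del (A B : Finset (ZMod p)) : ∑ l, del A B l = 0 := by
  unfold del
  rw [sum_sub_distrib, sum_const_real, ← Nat.cast_sum, sum_cnt]
  have := ppos (p := p)
  push_cast
  field_simp
  ring

lemma sum_del_sq (A B : Finset (ZMod p)) : ∑ l, del A B l ^ 2 ≤ p * (A.card * B.card) := by
  have hp := ppos (p := p)
  have h0 := sum_del A B
  have h1 : ∀ l, (cnt A B l : ℝ) ^ 2 = del A B l ^ 2 + 2 * ((A.card : ℝ) * B.card / p) * del A B l + ((A.card : ℝ) * B.card / p) ^ 2 := by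
    intro l
    unfold del
    ring
  have h2 : ∑ l, (cnt A B l : ℝ) ^ 2 = ∑ l, del A B l ^ 2 + ((A.card : ℝ) * B.card) ^ 2 := by
    simp only [h1]
    rw [sum_add_distrib, sum_add_distrib, ← mul_sum, h0, sum_const_real]
    field_simp
    ring
  have h3 : ∑ l : ZMod p × ZMod p, (cnt A B l : ℝ) ^ 2 ≤ p * (A.card * B.card) + ((A.card : ℝ) * B.card) ^ 2 := by
    exact_mod_cast sum_cnt_sq A B
  linarith

lemma g_bound (A B : Finset (ZMod p)) (hAB : A.card ≤ B.card) (n : ℕ) : ∀ (k : ℕ), 2 ≤ k → A.card < k + n →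
    80000000000 * ((A.card : ℝ) ^ 4 * (B.card : ℝ) ^ 2) < (k : ℝ) ^ 4 * (p : ℝ) ^ 2 →
    (k : ℝ) * ∑ l ∈ LL A B k, (cnt A B l : ℝ) ^ 3 ≤ 640000000000 * ((A.card : ℝ) ^ 3 * (B.card : ℝ) ^ 2) := by
  induction n with
  | zero =>
    intro k hk hA _
    have : LL A B k = ∅ := by
      apply filter_eq_empty_iff.2
      intro l _ h
      have : cnt A B l ≤ A.card := card_filter_le _ _
      omega
    rw [this]
    simp
    positivity
  | succ n ih =>
    intro k hk hA hbig
    have hk0 : (0 : ℝ) < k := by exact_mod_cast (by omega : 0 < k)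
    have h1 := ih (2 * k) (by omega) (by omega) (hbig.trans_le (by
      push_cast
      gcongr
      linarith))
    have h2 := rich_full A B hAB k hk hbig
    have h3 : ∑ l ∈ LL A B k, (cnt A B l : ℝ) ^ 3 ≤ (LL A B k).card * (2 * (k : ℝ)) ^ 3 + ∑ l ∈ LL A B (2 * k), (cnt A B l : ℝ) ^ 3 := by
      rw [← sum_filter_add_sum_filter_not (LL A B k) (fun l => cnt A B l ≤ 2 * k)]
      apply add_le_add
      · rw [← nsmul_eq_mul]
        refine (sum_le_card_nsmul _ _ ((2 * (k : ℝ)) ^ 3) ?_).trans ?_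
        · intro l hl
          have := (mem_filter.1 hl).2
          have : (cnt A B l : ℝ) ≤ 2 * k := by exact_mod_cast this
          gcongr
        · rw [nsmul_eq_mul, nsmul_eq_mul]
          have : (((LL A B k).filter (fun l => cnt A B l ≤ 2 * k)).card : ℝ) ≤ (LL A B k).card := by
            exact_mod_cast card_filter_le _ _
          gcongr
      · apply sum_le_sum_of_subset_of_nonneg
        · intro l hl
          have := (mem_filter.1 hl).2
          exact mem_filter.2 ⟨mem_univ _, by omega⟩
        · intros; positivity
    have h4 := mul_le_mul_of_nonneg_left h3 hk0.le
    push_cast at h1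
    linarith

lemma cube_bound (A B : Finset (ZMod p)) (hAB : A.card ≤ B.card) (M : ℝ) (hM : 2 ≤ M)
    (hMe : (A.card : ℝ) * B.card / p ≤ M)
    (hbig : 80000000000 * ((A.card : ℝ) ^ 4 * (B.card : ℝ) ^ 2) < M ^ 4 * (p : ℝ) ^ 2) :
    ∑ l, |del A B l| ^ 3 ≤ M * (p * (A.card * B.card)) + 640000000000 * ((A.card : ℝ) ^ 3 * (B.card : ℝ) ^ 2) / M := by
  have hM0 : 0 < M := by linarith
  have he : 0 ≤ (A.card : ℝ) * B.card / p := by positivity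
  have hk : M ≤ (⌈M⌉₊ : ℝ) := Nat.le_ceil M
  set k := ⌈M⌉₊ with hkdef
  have hk2 : 2 ≤ k := by
    have : (2 : ℝ) ≤ k := hM.trans hk
    exact_mod_cast this
  have hp := ppos (p := p)
  have h1 := g_bound A B hAB (A.card + 1) k hk2 (by omega) (hbig.trans_le (by gcongr))
  have h2 : ∑ l ∈ LL A B k, (cnt A B l : ℝ) ^ 3 ≤ 640000000000 * ((A.card : ℝ) ^ 3 * (B.card : ℝ) ^ 2) / M := by
    rw [le_div_iff₀ hM0]
    refine le_trans ?_ h1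
    rw [mul_comm]
    have : 0 ≤ ∑ l ∈ LL A B k, (cnt A B l : ℝ) ^ 3 := sum_nonneg (fun _ _ => by positivity)
    gcongr
  have h3 : ∀ l, |del A B l| ^ 3 ≤ M * del A B l ^ 2 + (if k ≤ cnt A B l then (cnt A B l : ℝ) ^ 3 else 0) := by
    intro l
    rcases le_or_gt |del A B l| M with h | h
    · have e1 : |del A B l| ^ 3 ≤ M * del A B l ^ 2 := by
        rw [← sq_abs, pow_succ', ]
        gcongr
      have e2 : 0 ≤ (if k ≤ cnt A B l then (cnt A B l : ℝ) ^ 3 else 0) := by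
        split_ifs <;> positivity
      linarith
    · have hc : (0 : ℝ) ≤ cnt A B l := by positivity
      have e0 : |del A B l| ≤ cnt A B l := by
        rcases le_or_gt 0 (del A B l) with h' | h'
        · rw [abs_of_nonneg h']
          unfold del
          linarith
        · rw [abs_of_neg h'] at h
          unfold del at h
          linarith
      have e1 : k ≤ cnt A B l := Nat.ceil_le.2 (h.le.trans e0)
      rw [if_pos e1]
      have e2 : |del A B l| ^ 3 ≤ (cnt A B l : ℝ) ^ 3 := by gcongr
      have e3 : 0 ≤ M * del A B l ^ 2 := by positivity
      linarith
  refine (sum_le_sum (fun l _ => h3 l)).trans ?_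
  rw [sum_add_distrib, ← mul_sum, ← sum_filter]
  apply add_le_add
  · have := sum_del_sq A B
    gcongr
  · exact h2

lemma S_expand (A B A' B' : Finset (ZMod p)) (hA : A'.card = A.card) (hB : B'.card = B.card) :
    |∑ l, (cnt A B l : ℝ) * (cnt A' B' l : ℝ) ^ 2 - (A.card : ℝ) ^ 3 * (B.card : ℝ) ^ 3 / p| ≤
      3 * ((A.card : ℝ) * B.card) ^ 2 + ∑ l, |del A B l| ^ 3 + ∑ l, |del A' B' l| ^ 3 := by
  have hp := ppos (p := p)
  set e : ℝ := (A.card : ℝ) * B.card / p with he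
  have he0 : 0 ≤ e := by positivity
  have hep : e * p = (A.card : ℝ) * B.card := by rw [he]; field_simp
  have z1 := sum_del A B
  have z2 := sum_del A' B'
  have q1 := sum_del_sq A B
  have q2 := sum_del_sq A' B'
  rw [hA, hB] at q2
  have c1 : ∀ l, (cnt A B l : ℝ) * (cnt A' B' l : ℝ) ^ 2 =
     e ^ 3 + e ^ 2 * del A B l + 2 * e ^ 2 * del A' B' l + e * (del A' B' l ^ 2 + 2 * (del A B l * del A' B' l)) + del A B l * del A' B' l ^ 2 := by
    intro l
    simp only [del, hA, hB, ← he]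
    ring
  have c2 : ∑ l, (cnt A B l : ℝ) * (cnt A' B' l : ℝ) ^ 2 = (A.card : ℝ) ^ 3 * (B.card : ℝ) ^ 3 / p
     + e * (∑ l, (del A' B' l ^ 2 + 2 * (del A B l * del A' B' l))) + ∑ l, del A B l * del A' B' l ^ 2 := by
    simp only [c1]
    rw [sum_add_distrib, sum_add_distrib, sum_add_distrib, sum_add_distrib, ← mul_sum, ← mul_sum, ← mul_sum, z1, z2, sum_const_real]
    have : (p : ℝ) ^ 2 * e ^ 3 = (A.card : ℝ) ^ 3 * (B.card : ℝ) ^ 3 / p := by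
      rw [he]; field_simp
    rw [this]
    ring
  have c3 : |∑ l, (del A' B' l ^ 2 + 2 * (del A B l * del A' B' l))| ≤ (3 : ℝ) * ((p : ℝ) * ((A.card : ℝ) * B.card)) := by
    refine (abs_sum_le_sum_abs _ _).trans ?_
    have : ∀ l, |del A' B' l ^ 2 + 2 * (del A B l * del A' B' l)| ≤ 2 * del A' B' l ^ 2 + del A B l ^ 2 := by
      intro l
      rw [abs_le]
      constructor <;> nlinarith [sq_nonneg (del A B l + del A' B' l), sq_nonneg (del A B l - del A' B' l), sq_nonneg (del A' B' l)]
    refine (sum_le_sum (fun l _ => this l)).trans ?_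
    rw [sum_add_distrib, ← mul_sum]
    linarith
  have c4 : |∑ l, del A B l * del A' B' l ^ 2| ≤ ∑ l, |del A B l| ^ 3 + ∑ l, |del A' B' l| ^ 3 := by
    rw [← sum_add_distrib]
    refine (abs_sum_le_sum_abs _ _).trans (sum_le_sum ?_)
    intro l _
    rw [abs_mul, abs_pow]
    have ha := abs_nonneg (del A B l)
    have hb := abs_nonneg (del A' B' l)
    generalize |del A B l| = x at *
    generalize |del A' B' l| = y at *
    rcases le_total x y with h | h
    · have : x * y ^ 2 ≤ y * y ^ 2 := by gcongr
      have : 0 ≤ x ^ 3 := by positivity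
      linarith
    · have : x * y ^ 2 ≤ x * x ^ 2 := by gcongr
      have : 0 ≤ y ^ 3 := by positivity
      linarith
  have c5 : |e * ∑ l, (del A' B' l ^ 2 + 2 * (del A B l * del A' B' l))| ≤ 3 * ((A.card : ℝ) * B.card) ^ 2 := by
    rw [abs_mul, abs_of_nonneg he0]
    have := mul_le_mul_of_nonneg_left c3 he0
    have h' : e * (3 * (p * (A.card * B.card))) = 3 * ((A.card : ℝ) * B.card) ^ 2 := by
      rw [sq, ← hep]; ring
    linarith
  rw [c2]
  rw [abs_le] at c4 c5 ⊢
  constructor <;> linarith [c4.1, c4.2, c5.1, c5.2]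

end CT

namespace CT
open scoped Classical

variable {p : ℕ} [Fact p.Prime]

/-- collinear condition -/
def CC {K : Type*} [Field K] (t : (K × K) × (K × K) × (K × K)) : Prop :=
  (t.1.1 - t.2.1.1) * (t.1.2 - t.2.2.2) = (t.1.1 - t.2.2.1) * (t.1.2 - t.2.1.2)

/-- all triples -/
noncomputable def TA (A B A' B' : Finset (ZMod p)) : Finset ((ZMod p × ZMod p) × (ZMod p × ZMod p) × (ZMod p × ZMod p)) :=
  (A ×ˢ B) ×ˢ (A' ×ˢ B') ×ˢ (A' ×ˢ B')

lemma mem_TA (A B A' B' : Finset (ZMod p)) (t) : t ∈ TA A B A' B' ↔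
   (t.1.1 ∈ A ∧ t.1.2 ∈ B) ∧ (t.2.1.1 ∈ A' ∧ t.2.1.2 ∈ B') ∧ (t.2.2.1 ∈ A' ∧ t.2.2.2 ∈ B') := by
  simp only [TA, mem_product]

lemma T_eq (A B : Finset (ZMod p)) (lam mu : ZMod p) (hl : lam ≠ 0) (hm : mu ≠ 0) :
    collinearTriples A B lam mu =
      ((TA A B (A.image (fun x => lam * x)) (B.image (fun x => mu * x))).filter CC).card := by
  unfold collinearTriples
  rw [Fintype.card_subtype]
  apply card_bij (fun t _ => ((t.1, t.2.2.2.1), (lam * t.2.1, mu * t.2.2.2.2.2), (lam * t.2.2.1, mu * t.2.2.2.2.1)))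
  · intro t ht
    simp only [mem_filter, mem_univ, true_and] at ht
    obtain ⟨h1, h2, h3, h4, h5, h6, h7⟩ := ht
    rw [mem_filter, mem_TA]
    refine ⟨⟨⟨h1, h4⟩, ⟨mem_image_of_mem _ h2, mem_image_of_mem _ h6⟩, ⟨mem_image_of_mem _ h3, mem_image_of_mem _ h5⟩⟩, h7⟩
  · rintro ⟨a, b, c, d, e, f⟩ _ ⟨a', b', c', d', e', f'⟩ _ h
    simp only [Prod.mk.injEq, mul_right_inj' hl, mul_right_inj' hm] at h
    obtain ⟨⟨rfl, rfl⟩, ⟨rfl, rfl⟩, rfl, rfl⟩ := h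
    rfl
  · rintro ⟨⟨x1, y1⟩, ⟨x2, y2⟩, ⟨x3, y3⟩⟩ ht
    rw [mem_filter, mem_TA] at ht
    obtain ⟨⟨⟨h1, h2⟩, ⟨h3, h4⟩, ⟨h5, h6⟩⟩, h7⟩ := ht
    obtain ⟨a2, ha2, e2⟩ := mem_image.1 h3
    obtain ⟨b3, hb3, e3⟩ := mem_image.1 h4
    obtain ⟨a3, ha3, e4⟩ := mem_image.1 h5
    obtain ⟨b2, hb2, e5⟩ := mem_image.1 h6
    simp only at e2 e3 e4 e5
    subst e2 e3 e4 e5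
    refine ⟨(x1, a2, a3, y1, b2, b3), ?_, rfl⟩
    simp only [mem_filter, mem_univ, true_and]
    exact ⟨h1, ha2, ha3, h2, hb2, hb3, h7⟩

/-- number of lines through three points -/
noncomputable def NN (t : (ZMod p × ZMod p) × (ZMod p × ZMod p) × (ZMod p × ZMod p)) : ℕ :=
  (univ.filter (fun l : ZMod p × ZMod p => l.1 * t.1.1 + l.2 = t.1.2 ∧ l.1 * t.2.1.1 + l.2 = t.2.1.2 ∧
    l.1 * t.2.2.1 + l.2 = t.2.2.2)).card

lemma cnt_eq (A B : Finset (ZMod p)) (l : ZMod p × ZMod p) :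
    cnt A B l = ∑ q ∈ A ×ˢ B, if l.1 * q.1 + l.2 = q.2 then 1 else 0 := by
  rw [cnt, card_filter, sum_product]
  apply sum_congr rfl
  intro a _
  simp only
  rw [sum_ite_eq]

lemma S_eq (A B A' B' : Finset (ZMod p)) :
    ∑ l, cnt A B l * cnt A' B' l ^ 2 = ∑ t ∈ TA A B A' B', NN t := by
  unfold NN TA
  simp only [card_filter]
  rw [sum_comm]
  apply sum_congr rfl
  intro l _
  rw [cnt_eq, cnt_eq, ← card_filter, ← card_filter, sq, ← card_product, ← card_product, ← filter_product, ← filter_product, card_filter]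

lemma NN_le (t : (ZMod p × ZMod p) × (ZMod p × ZMod p) × (ZMod p × ZMod p)) : NN t ≤ p := by
  have : NN t ≤ (univ : Finset (ZMod p)).card := by
    apply card_le_card_of_injOn (fun l => l.1)
    · intro l _
      simp
    · intro l hl l' hl' h
      simp only [coe_filter, mem_univ, true_and, Set.mem_ofPred_eq] at hl hl'
      refine Prod.ext h ?_
      simp only at h
      have h1 := hl.1
      rw [← hl'.1, h] at h1
      exact add_left_cancel h1
  simpa [ZMod.card] using this

lemma NN_zero (t : (ZMod p × ZMod p) × (ZMod p × ZMod p) × (ZMod p × ZMod p)) (h : ¬ CC t) : NN t = 0 := by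
  unfold NN
  rw [card_eq_zero, filter_eq_empty_iff]
  rintro l _ ⟨h1, h2, h3⟩
  apply h
  unfold CC
  rw [← h1, ← h2, ← h3]
  ring

lemma NN_one (t : (ZMod p × ZMod p) × (ZMod p × ZMod p) × (ZMod p × ZMod p)) (h : CC t)
    (hx : t.1.1 ≠ t.2.1.1) : NN t = 1 := by
  unfold NN
  rw [card_eq_one]
  have hx' := sub_ne_zero.2 hx
  unfold CC at h
  refine ⟨((t.1.2 - t.2.1.2) / (t.1.1 - t.2.1.1), t.1.2 - (t.1.2 - t.2.1.2) / (t.1.1 - t.2.1.1) * t.1.1), ?_⟩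
  have hm : (t.1.2 - t.2.1.2) / (t.1.1 - t.2.1.1) * (t.1.1 - t.2.1.1) = t.1.2 - t.2.1.2 := div_mul_cancel₀ _ hx'
  generalize (t.1.2 - t.2.1.2) / (t.1.1 - t.2.1.1) = m at *
  ext l
  simp only [mem_filter, mem_univ, true_and, mem_singleton]
  constructor
  · rintro ⟨h1, h2, h3⟩
    have e : l.1 = m := by
      apply mul_right_cancel₀ hx'
      linear_combination h1 - h2 - hm
    refine Prod.ext e ?_
    simp only
    rw [← e, ← h1]
    ring
  · rintro rfl
    simp only
    refine ⟨by ring, by linear_combination -hm, ?_⟩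
    apply mul_left_cancel₀ hx'
    linear_combination h - (t.1.1 - t.2.2.1) * hm

lemma NN_swap (a b c : ZMod p × ZMod p) : NN (a, b, c) = NN (a, c, b) := by
  unfold NN
  congr 1
  apply filter_congr
  intro l _
  simp only
  tauto

lemma NN_col (t : (ZMod p × ZMod p) × (ZMod p × ZMod p) × (ZMod p × ZMod p)) :
    |(if CC t then (1 : ℝ) else 0) - NN t| ≤ (if t.1.1 = t.2.1.1 ∧ t.1.1 = t.2.2.1 then 1 else 0)
      + p * (if t.1 = t.2.1 ∧ t.1 = t.2.2 then 1 else 0) := by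
  have hR : 0 ≤ (if t.1.1 = t.2.1.1 ∧ t.1.1 = t.2.2.1 then (1 : ℝ) else 0)
      + p * (if t.1 = t.2.1 ∧ t.1 = t.2.2 then 1 else 0) := by
    apply add_nonneg
    · split_ifs <;> norm_num
    · apply mul_nonneg
      · positivity
      · split_ifs <;> norm_num
  by_cases h : CC t
  · rw [if_pos h]
    by_cases hx : t.1.1 = t.2.1.1 ∧ t.1.1 = t.2.2.1
    · rw [if_pos hx]
      by_cases hy : t.1 = t.2.1 ∧ t.1 = t.2.2
      · rw [if_pos hy]
        have h1 : (NN t : ℝ) ≤ p := by exact_mod_cast NN_le t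
        have h2 : (0 : ℝ) ≤ NN t := by positivity
        rw [abs_le]
        constructor <;> linarith
      · rw [if_neg hy]
        have : NN t = 0 := by
          unfold NN
          rw [card_eq_zero, filter_eq_empty_iff]
          rintro l _ ⟨h1, h2, h3⟩
          apply hy
          refine ⟨Prod.ext hx.1 ?_, Prod.ext hx.2 ?_⟩
          · rw [← h1, ← h2, hx.1]
          · rw [← h1, ← h3, hx.2]
        rw [this]
        norm_num
    · have : NN t = 1 := by
        by_cases h1 : t.1.1 = t.2.1.1
        · have h2 : t.1.1 ≠ t.2.2.1 := fun h2 => hx ⟨h1, h2⟩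
          obtain ⟨a, b, c⟩ := t
          rw [NN_swap]
          apply NN_one
          · unfold CC at *
            exact h.symm
          · exact h2
        · exact NN_one t h h1
      rw [this]
      simpa using hR
  · rw [if_neg h, NN_zero t h]
    simpa using hR

lemma vert_count (A B A' B' : Finset (ZMod p)) :
    ((TA A B A' B').filter (fun t => t.1.1 = t.2.1.1 ∧ t.1.1 = t.2.2.1)).card ≤ A.card * (B.card * (B'.card * B'.card)) := by
  simp only [← card_product]
  apply card_le_card_of_injOn (fun t => (t.1.1, t.1.2, t.2.1.2, t.2.2.2))
  · intro t ht
    rw [mem_coe, mem_filter, mem_TA] at ht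
    simp only [coe_product, Set.mem_prod, mem_coe]
    tauto
  · rintro ⟨⟨x1, y1⟩, ⟨x2, y2⟩, ⟨x3, y3⟩⟩ ht ⟨⟨x1', y1'⟩, ⟨x2', y2'⟩, ⟨x3', y3'⟩⟩ ht' h
    have h1 := (mem_filter.1 (mem_coe.1 ht)).2
    have h2 := (mem_filter.1 (mem_coe.1 ht')).2
    simp only [Prod.mk.injEq] at *
    obtain ⟨rfl, rfl⟩ := h1
    obtain ⟨rfl, rfl⟩ := h2
    tauto

lemma eq_count (A B A' B' : Finset (ZMod p)) :
    ((TA A B A' B').filter (fun t => t.1 = t.2.1 ∧ t.1 = t.2.2)).card ≤ A.card * B.card := by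
  simp only [← card_product]
  apply card_le_card_of_injOn (fun t => t.1)
  · intro t ht
    rw [mem_coe, mem_filter, mem_TA] at ht
    simp only [coe_product, Set.mem_prod, mem_coe]
    tauto
  · rintro ⟨a, b, c⟩ ht ⟨a', b', c'⟩ ht' h
    have h1 := (mem_filter.1 (mem_coe.1 ht)).2
    have h2 := (mem_filter.1 (mem_coe.1 ht')).2
    simp only at *
    obtain ⟨rfl, rfl⟩ := h1
    obtain ⟨rfl, rfl⟩ := h2
    subst h
    rfl

lemma TS (A B A' B' : Finset (ZMod p)) :
    |(((TA A B A' B').filter CC).card : ℝ) - ∑ l, (cnt A B l : ℝ) * (cnt A' B' l : ℝ) ^ 2| ≤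
      A.card * (B.card * (B'.card * B'.card)) + p * (A.card * B.card) := by
  have h1 : ∑ l, (cnt A B l : ℝ) * (cnt A' B' l : ℝ) ^ 2 = ∑ t ∈ TA A B A' B', (NN t : ℝ) := by
    exact_mod_cast S_eq A B A' B'
  have h2 : (((TA A B A' B').filter CC).card : ℝ) = ∑ t ∈ TA A B A' B', (if CC t then (1 : ℝ) else 0) := by
    rw [card_filter]; push_cast; rfl
  rw [h1, h2, ← sum_sub_distrib]
  refine (abs_sum_le_sum_abs _ _).trans ((sum_le_sum (fun t _ => NN_col t)).trans ?_)
  rw [sum_add_distrib, ← mul_sum]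
  have h3 := vert_count A B A' B'
  have h4 := eq_count A B A' B'
  rw [card_filter] at h3 h4
  have h3' : ∑ t ∈ TA A B A' B', (if t.1.1 = t.2.1.1 ∧ t.1.1 = t.2.2.1 then (1 : ℝ) else 0) ≤ A.card * (B.card * (B'.card * B'.card)) := by
    exact_mod_cast h3
  have h4' : ∑ t ∈ TA A B A' B', (if t.1 = t.2.1 ∧ t.1 = t.2.2 then (1 : ℝ) else 0) ≤ A.card * B.card := by
    exact_mod_cast h4
  gcongr

lemma T_triv (A B A' B' : Finset (ZMod p)) :
    ((TA A B A' B').filter CC).card ≤ A.card * (B.card * (A'.card * (A'.card * B'.card)))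
      + A.card * (B.card * (B'.card * B'.card)) + A.card * (B.card * (A'.card * B'.card)) := by
  have hsub : (TA A B A' B').filter CC ⊆
      (((TA A B A' B').filter (fun t => CC t ∧ t.1.1 ≠ t.2.2.1)) ∪
      ((TA A B A' B').filter (fun t => t.1.1 = t.2.1.1 ∧ t.1.1 = t.2.2.1))) ∪
      ((TA A B A' B').filter (fun t => t.1.1 = t.2.2.1 ∧ t.1.2 = t.2.2.2)) := by
    intro t ht
    rw [mem_filter] at ht
    rw [mem_union, mem_union, mem_filter, mem_filter, mem_filter]
    by_cases h1 : t.1.1 = t.2.2.1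
    · have h2 := ht.2
      unfold CC at h2
      rw [sub_eq_zero.2 h1, zero_mul, mul_eq_zero, sub_eq_zero, sub_eq_zero] at h2
      tauto
    · tauto
  refine (card_le_card hsub).trans ((card_union_le _ _).trans (Nat.add_le_add ((card_union_le _ _).trans (Nat.add_le_add ?_ ?_)) ?_))
  · simp only [← card_product]
    apply card_le_card_of_injOn (fun t => (t.1.1, t.1.2, t.2.1.1, t.2.2.1, t.2.2.2))
    · intro t ht
      rw [mem_coe, mem_filter, mem_TA] at ht
      simp only [coe_product, Set.mem_prod, mem_coe]
      tauto
    · rintro ⟨⟨x1, y1⟩, ⟨x2, y2⟩, ⟨x3, y3⟩⟩ ht ⟨⟨x1', y1'⟩, ⟨x2', y2'⟩, ⟨x3', y3'⟩⟩ ht' h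
      have h1 := (mem_filter.1 (mem_coe.1 ht)).2
      have h2 := (mem_filter.1 (mem_coe.1 ht')).2
      simp only [Prod.mk.injEq, CC] at *
      obtain ⟨rfl, rfl, rfl, rfl, rfl⟩ := h
      have : y2 = y2' := by
        have h3 := h1.1.symm.trans h2.1
        have h4 := mul_left_cancel₀ (sub_ne_zero.2 h1.2) h3
        linear_combination -h4
      subst this
      tauto
  · exact vert_count A B A' B'
  · simp only [← card_product]
    apply card_le_card_of_injOn (fun t => (t.1.1, t.1.2, t.2.1.1, t.2.1.2))
    · intro t ht
      rw [mem_coe, mem_filter, mem_TA] at ht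
      simp only [coe_product, Set.mem_prod, mem_coe]
      tauto
    · rintro ⟨⟨x1, y1⟩, ⟨x2, y2⟩, ⟨x3, y3⟩⟩ ht ⟨⟨x1', y1'⟩, ⟨x2', y2'⟩, ⟨x3', y3'⟩⟩ ht' h
      have h1 := (mem_filter.1 (mem_coe.1 ht)).2
      have h2 := (mem_filter.1 (mem_coe.1 ht')).2
      simp only [Prod.mk.injEq] at *
      obtain ⟨rfl, rfl⟩ := h1
      obtain ⟨rfl, rfl⟩ := h2
      tauto

end CT

namespace CT
open scoped Classical

variable {p : ℕ} [Fact p.Prime]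

lemma fin_small (A B b r P T : ℝ) (hA : 0 ≤ A) (hb : 0 ≤ b) (hr : 0 < r) (hB : b ^ 2 = B) (hP : r ^ 2 = P)
    (hB1 : B ^ 2 ≤ B ^ 3) (hAB : A ≤ B) (hAb : A * b ≤ r) (hT0 : 0 ≤ T)
    (hT : T ≤ A * (B * (A * (A * B))) + A * (B * (B * B)) + A * (B * (A * B))) :
    |T - A ^ 3 * B ^ 3 / P| ≤ 10000000000 * (r * A ^ 2 * b ^ 3 + A * B ^ 3) := by
  have hB0 : 0 ≤ B := by rw [← hB]; positivity
  have hP0 : 0 < P := by rw [← hP]; positivity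
  have h1 : A ^ 3 * B ^ 3 / P ≤ A * B ^ 3 := by
    rw [div_le_iff₀ hP0]
    have e1 : (A * b) ^ 2 ≤ r ^ 2 := by gcongr
    have e2 : A ^ 2 * B ≤ P := by
      rw [← hB, ← hP]; linarith
    have e3 : A * B ^ 2 * (A ^ 2 * B) ≤ A * B ^ 2 * P := by gcongr
    have e4 : A * P * B ^ 2 ≤ A * P * B ^ 3 := by gcongr
    linarith
  have h2 : A ^ 3 * B ^ 2 ≤ r * A ^ 2 * b ^ 3 := by
    have e1 : (A ^ 2 * b ^ 3) * (A * b) ≤ (A ^ 2 * b ^ 3) * r := by gcongr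
    rw [← hB]; linarith
  have h3 : A * B ^ 2 * A ≤ A * B ^ 2 * B := by gcongr
  have h4 : 0 ≤ A ^ 3 * B ^ 3 / P := by positivity
  have h5 : 0 ≤ r * A ^ 2 * b ^ 3 := by positivity
  have h6 : 0 ≤ A * B ^ 3 := by positivity
  rw [abs_le]
  constructor <;> linarith

lemma fin_big (A B b r P T S X Y : ℝ) (hA : 0 < A) (hb : 0 < b) (hr : 0 < r) (hB : b ^ 2 = B) (hP : r ^ 2 = P)
    (hbr : b ≤ r) (hAb : r ≤ A * b)
    (hTS : |T - S| ≤ A * (B * (B * B)) + P * (A * B))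
    (hS : |S - A ^ 3 * B ^ 3 / P| ≤ 3 * (A * B) ^ 2 + X + Y)
    (hX : X ≤ (1000 * (A * b / r)) * (P * (A * B)) + 640000000000 * (A ^ 3 * B ^ 2) / (1000 * (A * b / r)))
    (hY : Y ≤ (1000 * (A * b / r)) * (P * (A * B)) + 640000000000 * (A ^ 3 * B ^ 2) / (1000 * (A * b / r))) :
    |T - A ^ 3 * B ^ 3 / P| ≤ 10000000000 * (r * A ^ 2 * b ^ 3 + A * B ^ 3) := by
  have h1 : (1000 * (A * b / r)) * (P * (A * B)) = 1000 * (r * A ^ 2 * b ^ 3) := by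
    rw [← hB, ← hP]; field_simp
  have h2 : 640000000000 * (A ^ 3 * B ^ 2) / (1000 * (A * b / r)) = 640000000 * (r * A ^ 2 * b ^ 3) := by
    rw [← hB]; field_simp; norm_num
  have h3 : (A * B) ^ 2 ≤ r * A ^ 2 * b ^ 3 := by
    have e1 : (A ^ 2 * b ^ 3) * b ≤ (A ^ 2 * b ^ 3) * r := by gcongr
    rw [← hB]; linarith
  have h4 : P * (A * B) ≤ r * A ^ 2 * b ^ 3 := by
    have e1 : (r * A * b ^ 2) * r ≤ (r * A * b ^ 2) * (A * b) := by gcongr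
    rw [← hB, ← hP]; linarith
  have h6 : 0 ≤ A * B ^ 3 := by rw [← hB]; positivity
  have h5 : 0 ≤ r * A ^ 2 * b ^ 3 := by positivity
  clear hB hP
  rw [h1, h2] at hX hY
  have h7 : |T - A ^ 3 * B ^ 3 / P| ≤ |T - S| + |S - A ^ 3 * B ^ 3 / P| := abs_sub_le _ _ _
  linarith

lemma main_aux (A B A' B' : Finset (ZMod p)) (hA : A'.card = A.card) (hB : B'.card = B.card) (hAB : A.card ≤ B.card) :
    |(((TA A B A' B').filter CC).card : ℝ) - (A.card : ℝ) ^ 3 * (B.card : ℝ) ^ 3 / p| ≤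
      10000000000 * (Real.sqrt p * (A.card : ℝ) ^ 2 * Real.sqrt B.card ^ 3 + A.card * (B.card : ℝ) ^ 3) := by
  have hp := ppos (p := p)
  have hr : 0 < Real.sqrt p := Real.sqrt_pos.2 hp
  have hP : Real.sqrt p ^ 2 = p := Real.sq_sqrt hp.le
  have hb : 0 ≤ Real.sqrt B.card := Real.sqrt_nonneg _
  have hb2 : Real.sqrt B.card ^ 2 = B.card := Real.sq_sqrt (by positivity)
  have hBp : B.card ≤ p := by
    have := card_le_univ B
    rwa [ZMod.card] at this
  have hbr : Real.sqrt B.card ≤ Real.sqrt p := Real.sqrt_le_sqrt (by exact_mod_cast hBp)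
  rcases le_or_gt ((A.card : ℝ) * Real.sqrt B.card) (Real.sqrt p) with h | h
  · have hT := T_triv A B A' B'
    rw [hA, hB] at hT
    apply fin_small _ _ _ _ _ _ (by positivity) hb hr hb2 hP ?_ (by exact_mod_cast hAB) h (by positivity) (by exact_mod_cast hT)
    have : B.card ^ 2 ≤ B.card ^ 3 := by
      rcases Nat.eq_zero_or_pos B.card with h0 | h0
      · rw [h0]; norm_num
      · exact Nat.pow_le_pow_right h0 (by norm_num)
    exact_mod_cast this
  · have hpos : 0 < (A.card : ℝ) * Real.sqrt B.card := hr.trans h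
    have hb' : 0 < Real.sqrt B.card := by
      rcases hb.lt_or_eq with h0 | h0
      · exact h0
      · rw [← h0] at hpos; simp at hpos
    have hA0 : 0 < (A.card : ℝ) := pos_of_mul_pos_left hpos hb
    have hTS := TS A B A' B'
    rw [hB] at hTS
    have hS := S_expand A B A' B' hA hB
    have hK : 1 < (A.card : ℝ) * Real.sqrt B.card / Real.sqrt p := by
      rwa [one_lt_div hr]
    have hM : 2 ≤ 1000 * ((A.card : ℝ) * Real.sqrt B.card / Real.sqrt p) := by linarith
    have hMe : (A.card : ℝ) * B.card / p ≤ 1000 * ((A.card : ℝ) * Real.sqrt B.card / Real.sqrt p) := by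
      have : (A.card : ℝ) * B.card / p ≤ (A.card : ℝ) * Real.sqrt B.card / Real.sqrt p := by
        rw [div_le_div_iff₀ hp hr]
        nth_rewrite 1 [← hb2]
        nth_rewrite 2 [← hP]
        have : ((A.card : ℝ) * Real.sqrt B.card * Real.sqrt p) * Real.sqrt B.card ≤ ((A.card : ℝ) * Real.sqrt B.card * Real.sqrt p) * Real.sqrt p := by gcongr
        linarith
      linarith
    have hbig : 80000000000 * ((A.card : ℝ) ^ 4 * (B.card : ℝ) ^ 2) < (1000 * ((A.card : ℝ) * Real.sqrt B.card / Real.sqrt p)) ^ 4 * (p : ℝ) ^ 2 := by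
      have e : (1000 * ((A.card : ℝ) * Real.sqrt B.card / Real.sqrt p)) ^ 4 * (p : ℝ) ^ 2 = 1000000000000 * ((A.card : ℝ) ^ 4 * (B.card : ℝ) ^ 2) := by
        generalize Real.sqrt p = r at *
        generalize Real.sqrt B.card = b at *
        rw [← hP, ← hb2]
        field_simp
        norm_num
      rw [e]
      have : 0 < (A.card : ℝ) ^ 4 * (B.card : ℝ) ^ 2 := by rw [← hb2]; positivity
      linarith
    have hX := cube_bound A B hAB _ hM hMe hbig
    have hY := cube_bound A' B' (by rw [hA, hB]; exact hAB) _ hM (by rw [hA, hB]; exact hMe) (by rw [hA, hB]; exact hbig)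
    rw [hA, hB] at hY
    exact fin_big _ _ _ _ _ _ _ _ _ hA0 hb' hr hb2 hP hbr h.le hTS hS hX hY

end CT

/-- Theorem 1.1: `|T_{λ,μ}(A,B) − A³B³/p| ≤ c (p^{1/2} A² B^{3/2} + A B³)`. -/
theorem collinearTriples_bound :
    ∃ c : ℝ, 0 < c ∧ ∀ (p : ℕ) (_ : Fact p.Prime) (A B : Finset (ZMod p))
      (lam mu : ZMod p), lam ≠ 0 → mu ≠ 0 → A.card ≤ B.card →
      |(collinearTriples A B lam mu : ℝ) - (A.card : ℝ) ^ 3 * (B.card : ℝ) ^ 3 / p|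
        ≤ c * ((p : ℝ) ^ ((1 : ℝ) / 2) * (A.card : ℝ) ^ 2 * (B.card : ℝ) ^ ((3 : ℝ) / 2)
            + (A.card : ℝ) * (B.card : ℝ) ^ 3) := by
  refine ⟨10000000000, by norm_num, ?_⟩
  intro p _ A B lam mu hl hm hAB
  classical
  rw [CT.T_eq A B lam mu hl hm]
  have e1 : (p : ℝ) ^ ((1 : ℝ) / 2) = Real.sqrt p := (Real.sqrt_eq_rpow _).symm
  have e2 : (B.card : ℝ) ^ ((3 : ℝ) / 2) = Real.sqrt B.card ^ 3 := by
    rw [Real.sqrt_eq_rpow, ← Real.rpow_natCast, ← Real.rpow_mul (by positivity)]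
    norm_num
  rw [e1, e2]
  have := CT.main_aux A B (A.image (fun x => lam * x)) (B.image (fun x => mu * x))
    (card_image_of_injective _ (mul_right_injective₀ hl)) (card_image_of_injective _ (mul_right_injective₀ hm)) hAB
  convert this
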